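/- arXiv:1110.2507 — 9 statements merged into one kernel-verified Lean document; each statement's English description precedes it below -/
import Mathlib

section
/- For every natural number n there exists a combinatorial triangulation of the torus (a finite simple connected graph G = (V,E) with a face family F as below, orientable, with Euler characteristic |V| − |E| + |F| = 0) such that |V| ≥ n and the antiferromagnetic Ising model on it has a non-degenerate groundstate, i.e., there is a spin assignment σ* : V → {−1,+1} such that the set of minimizers of H is exactly {σ*, −σ*}. -/
open scoped Classical

/-- A spin assignment: each vertex gets spin `+1` or `-1`. -/
def IsSpin {V : Type*} (σ : V → ℤ) : Prop := ∀ v, σ v = 1 ∨ σ v = -1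

/-- The antiferromagnetic Hamiltonian `H(σ) = Σ_{{u,v} ∈ E} σ(u) σ(v)`. -/
def Hamiltonian {V : Type*} (E : Finset (Sym2 V)) (σ : V → ℤ) : ℤ :=
  ∑ e ∈ E, Sym2.lift ⟨fun u v => σ u * σ v, fun u v => mul_comm _ _⟩ e

/-- Two faces share an edge through the vertex `v`. -/
def SharesEdgeAt {V : Type*} (v : V) (f g : Finset V) : Prop :=
  f ≠ g ∧ ∃ u, u ≠ v ∧ u ∈ f ∧ u ∈ g

/-- The faces containing `v` can be arranged in a single cyclic order in which
consecutive faces share an edge through `v`. -/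
def LinkIsCycle {V : Type*} (F : Finset (Finset V)) (v : V) : Prop :=
  ∃ (l : List (Finset V)) (h : l ≠ []), l.Nodup ∧
    (∀ f, f ∈ l ↔ f ∈ F ∧ v ∈ f) ∧
    List.Chain' (SharesEdgeAt v) l ∧
    SharesEdgeAt v (l.getLast h) (l.head h)

/-- Each face can be given a cyclic orientation of its vertices (a successor map which is a
cyclic permutation of the three vertices of the face) so that every edge receives opposite
directions from its two incident faces. -/
def Orientable {V : Type*} (F : Finset (Finset V)) : Prop :=
  ∃ o : Finset V → V → V,
    (∀ f ∈ F, ∀ v ∈ f, o f v ∈ f ∧ o f v ≠ v ∧ o f (o f v) ≠ v) ∧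
    (∀ f ∈ F, ∀ g ∈ F, f ≠ g → ∀ u w, u ∈ f → w ∈ f → u ∈ g → w ∈ g →
      o f u = w → o g w = u)

/-- A combinatorial triangulation of a closed surface: a finite simple connected graph
(given by its edge set `E`, with underlying graph `SimpleGraph.fromEdgeSet ↑E`) together
with a family `F` of 3-element subsets of `V` (faces), each spanning a triangle, such that
every edge lies in exactly two faces and the link of every vertex is a single cycle. -/
def IsCombTriangulation {V : Type*} [Fintype V] [DecidableEq V]
    (E : Finset (Sym2 V)) (F : Finset (Finset V)) : Prop :=
  (∀ e ∈ E, ¬ e.IsDiag) ∧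
  (SimpleGraph.fromEdgeSet (↑E : Set (Sym2 V))).Connected ∧
  (∀ f ∈ F, f.card = 3 ∧ ∀ u ∈ f, ∀ v ∈ f, u ≠ v → s(u, v) ∈ E) ∧
  (∀ e ∈ E, (F.filter (fun f => ∀ v ∈ e, v ∈ f)).card = 2) ∧
  (∀ v : V, LinkIsCycle F v)

/-- A ternary relation on vertices describing the oriented triangles of an oriented closed
surface: `T a b c` says that `a, b, c` is a triangle listed in positive order. -/
structure OrientedTriangles {V : Type*} (T : V → V → V → Prop) : Prop where
  rotate : ∀ {a b c}, T a b c → T b c a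
  apex_unique : ∀ {a b c d}, T a b c → T a b d → c = d
  opposite : ∀ {a b c}, T a b c → ∃ d, T b a d
  ne : ∀ {a b c}, T a b c → a ≠ b
  not_swap : ∀ {a b c}, T a b c → ¬ T b a c

/-- `L` lists the neighbours of `v` in the cyclic order given by the oriented triangles. -/
structure IsLink {V : Type*} (T : V → V → V → Prop) (v : V) (L : List V) : Prop where
  ne_nil : L ≠ []
  nodup : L.Nodup
  chain : L.IsChain (T v)
  close : T v (L.getLast ne_nil) (L.head ne_nil)
  complete : ∀ {a c}, T v a c → a ∈ L

/-- The triangles of `T`, without their orientation. -/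
noncomputable def faces {V : Type*} [Fintype V] [DecidableEq V] (T : V → V → V → Prop) :
    Finset (Finset V) :=
  Finset.univ.filter fun f => ∃ a b c, T a b c ∧ f = {a, b, c}

/-- The sides of the triangles of `T`. -/
noncomputable def edges {V : Type*} [Fintype V] (T : V → V → V → Prop) : Finset (Sym2 V) :=
  Finset.univ.filter fun e => ∃ a b c, T a b c ∧ e = s(a, b)

/-- No triangle of `T` is monochromatic. -/
def IsProper {V : Type*} (T : V → V → V → Prop) (σ : V → ℤ) : Prop :=
  ∀ a b c, T a b c → ¬ (σ a = σ b ∧ σ b = σ c)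

/-- The interaction of the two spins at the ends of an edge. -/
def interaction {V : Type*} (σ : V → ℤ) (e : Sym2 V) : ℤ :=
  Sym2.lift ⟨fun u v => σ u * σ v, fun _ _ => mul_comm _ _⟩ e

namespace IsLink

variable {V : Type*} {T : V → V → V → Prop} {v : V} {L : List V}

theorem exists_next (h : IsLink T v L) {a : V} (ha : a ∈ L) : ∃ c, T v a c := by
  obtain ⟨i, hi, rfl⟩ := List.getElem_of_mem ha
  by_cases hi' : i + 1 < L.length
  · exact ⟨_, List.isChain_iff_getElem.1 h.chain i hi'⟩
  · have := h.close
    rw [List.getLast_eq_getElem] at this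
    have e : L.length - 1 = i := by omega
    simp only [e] at this
    exact ⟨_, this⟩

end IsLink

namespace OrientedTriangles

variable {V : Type*} {T : V → V → V → Prop}

theorem ne_right (hT : OrientedTriangles T) {a b c : V} (h : T a b c) : b ≠ c :=
  hT.ne (hT.rotate h)

theorem ne_outer (hT : OrientedTriangles T) {a b c : V} (h : T a b c) : c ≠ a :=
  hT.ne (hT.rotate (hT.rotate h))

theorem not_flip (hT : OrientedTriangles T) {a b c : V} (h : T a b c) : ¬ T a c b :=
  fun h' => hT.not_swap (hT.rotate h) (hT.rotate (hT.rotate (hT.rotate (hT.rotate h'))))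

section Faces

variable [DecidableEq V]

theorem eq_of_face_eq (hT : OrientedTriangles T) {v b c b' c' : V} (h : T v b c)
    (h' : T v b' c') (e : ({v, b, c} : Finset V) = {v, b', c'}) : b = b' ∧ c = c' := by
  have hb : b ∈ ({v, b', c'} : Finset V) := e ▸ by simp
  simp only [Finset.mem_insert, Finset.mem_singleton] at hb
  rcases hb with rfl | rfl | rfl
  · exact absurd rfl (hT.ne h)
  · exact ⟨rfl, hT.apex_unique h h'⟩
  · have hc : c ∈ ({v, b', b} : Finset V) := e ▸ by simp
    simp only [Finset.mem_insert, Finset.mem_singleton] at hc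
    rcases hc with rfl | rfl | rfl
    · exact absurd rfl (hT.ne_outer h)
    · exact absurd h' (hT.not_flip h)
    · exact absurd rfl (hT.ne_right h)

theorem card_face (hT : OrientedTriangles T) {a b c : V} (h : T a b c) :
    ({a, b, c} : Finset V).card = 3 :=
  Finset.card_eq_three.2 ⟨a, b, c, hT.ne h, (hT.ne_outer h).symm, hT.ne_right h, rfl⟩

variable [Fintype V]

theorem mem_faces {f : Finset V} : f ∈ faces T ↔ ∃ a b c, T a b c ∧ f = {a, b, c} := by
  simp [faces]

theorem mem_edges {e : Sym2 V} : e ∈ edges T ↔ ∃ a b c, T a b c ∧ e = s(a, b) := by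
  simp [edges]

theorem mk_mem_edges (hT : OrientedTriangles T) {a b : V} :
    s(a, b) ∈ edges T ↔ ∃ c, T a b c := by
  rw [mem_edges]
  constructor
  · rintro ⟨x, y, c, h, e⟩
    rcases Sym2.eq_iff.1 e with ⟨rfl, rfl⟩ | ⟨rfl, rfl⟩
    · exact ⟨c, h⟩
    · exact hT.opposite h
  · rintro ⟨c, h⟩
    exact ⟨a, b, c, h, rfl⟩

theorem exists_of_mem_face (hT : OrientedTriangles T) {f : Finset V} {v : V}
    (hf : f ∈ faces T) (hv : v ∈ f) : ∃ b c, T v b c ∧ f = {v, b, c} := by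
  obtain ⟨x, y, z, h, rfl⟩ := mem_faces.1 hf
  simp only [Finset.mem_insert, Finset.mem_singleton] at hv
  rcases hv with rfl | rfl | rfl
  · exact ⟨_, _, h, rfl⟩
  · exact ⟨_, _, hT.rotate h, by ext; simp; tauto⟩
  · exact ⟨_, _, hT.rotate (hT.rotate h), by ext; simp; tauto⟩

theorem sides_mem_edges (hT : OrientedTriangles T) {f : Finset V} (hf : f ∈ faces T) {u v : V}
    (hu : u ∈ f) (hv : v ∈ f) (huv : u ≠ v) : s(u, v) ∈ edges T := by
  obtain ⟨b, c, h, rfl⟩ := hT.exists_of_mem_face hf hu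
  simp only [Finset.mem_insert, Finset.mem_singleton] at hv
  rcases hv with rfl | rfl | rfl
  · exact absurd rfl huv
  · exact hT.mk_mem_edges.2 ⟨_, h⟩
  · rw [Sym2.eq_swap]
    exact hT.mk_mem_edges.2 ⟨_, hT.rotate (hT.rotate h)⟩

theorem card_faces_of_edge (hT : OrientedTriangles T) {e : Sym2 V} (he : e ∈ edges T) :
    ((faces T).filter fun f => ∀ v ∈ e, v ∈ f).card = 2 := by
  obtain ⟨a, b, c, h, rfl⟩ := mem_edges.1 he
  obtain ⟨d, h'⟩ := hT.opposite h
  have key : ((faces T).filter fun f => ∀ v ∈ s(a, b), v ∈ f) = {{a, b, c}, {a, d, b}} := by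
    ext f
    simp only [Finset.mem_filter, Sym2.mem_iff, forall_eq_or_imp, forall_eq, Finset.mem_insert,
      Finset.mem_singleton]
    constructor
    · rintro ⟨hf, ha, hb⟩
      obtain ⟨x, y, h1, rfl⟩ := hT.exists_of_mem_face hf ha
      simp only [Finset.mem_insert, Finset.mem_singleton] at hb
      rcases hb with rfl | rfl | rfl
      · exact absurd rfl (hT.ne h)
      · rw [hT.apex_unique h1 h]; exact Or.inl rfl
      · rw [hT.apex_unique h' (hT.rotate (hT.rotate h1))]; exact Or.inr rfl
    · rintro (rfl | rfl)
      · exact ⟨mem_faces.2 ⟨_, _, _, h, rfl⟩, by simp, by simp⟩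
      · exact ⟨mem_faces.2 ⟨_, _, _, hT.rotate h', rfl⟩, by simp, by simp⟩
  rw [key, Finset.card_pair]
  intro e
  obtain ⟨rfl, rfl⟩ := hT.eq_of_face_eq h (hT.rotate h') e
  exact hT.ne_right h rfl

theorem edges_of_face (hT : OrientedTriangles T) {a b c : V} (h : T a b c) :
    ((edges T).filter fun e => ∀ v ∈ e, v ∈ ({a, b, c} : Finset V)) =
      {s(a, b), s(b, c), s(c, a)} := by
  have hf : ({a, b, c} : Finset V) ∈ faces T := mem_faces.2 ⟨_, _, _, h, rfl⟩
  have h1 := hT.ne h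
  have h2 := hT.ne_right h
  have h3 := hT.ne_outer h
  ext e
  simp only [Finset.mem_filter, Finset.mem_insert, Finset.mem_singleton]
  constructor
  · rintro ⟨he, hv⟩
    obtain ⟨x, y, z, hxy, rfl⟩ := mem_edges.1 he
    have hne := hT.ne hxy
    have hx := hv x (by simp)
    have hy := hv y (by simp)
    simp only [Sym2.eq_iff]
    grind
  · rintro (rfl | rfl | rfl)
    · exact ⟨hT.sides_mem_edges hf (by simp) (by simp) h1, by simp⟩
    · exact ⟨hT.sides_mem_edges hf (by simp) (by simp) h2, by simp⟩
    · exact ⟨hT.sides_mem_edges hf (by simp) (by simp) h3, by simp⟩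

theorem sum_edges_of_face (hT : OrientedTriangles T) {a b c : V} (h : T a b c)
    (w : Sym2 V → ℤ) :
    ∑ e ∈ (edges T).filter (fun e => ∀ v ∈ e, v ∈ ({a, b, c} : Finset V)), w e =
      w s(a, b) + w s(b, c) + w s(c, a) := by
  have h1 := hT.ne h
  have h2 := hT.ne_right h
  have h3 := hT.ne_outer h
  rw [hT.edges_of_face h, Finset.sum_insert, Finset.sum_insert, Finset.sum_singleton, add_assoc]
  · simp only [Finset.mem_singleton, Sym2.eq_iff]; grind
  · simp only [Finset.mem_insert, Finset.mem_singleton, Sym2.eq_iff]; grind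

theorem two_mul_sum_edges (hT : OrientedTriangles T) (w : Sym2 V → ℤ) :
    2 * ∑ e ∈ edges T, w e =
      ∑ f ∈ faces T, ∑ e ∈ (edges T).filter (fun e => ∀ v ∈ e, v ∈ f), w e := by
  simp only [Finset.sum_filter]
  rw [Finset.sum_comm, Finset.mul_sum]
  refine Finset.sum_congr rfl fun e he => ?_
  rw [← Finset.sum_filter, Finset.sum_const, hT.card_faces_of_edge he]
  simp

theorem two_mul_card_edges (hT : OrientedTriangles T) :
    2 * (edges T).card = 3 * (faces T).card := by
  have h := hT.two_mul_sum_edges fun _ => 1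
  have h3 : ∑ f ∈ faces T, ∑ e ∈ (edges T).filter (fun e => ∀ v ∈ e, v ∈ f), (1 : ℤ) =
      ∑ f ∈ faces T, 3 := by
    refine Finset.sum_congr rfl fun f hf => ?_
    obtain ⟨a, b, c, h, rfl⟩ := mem_faces.1 hf
    rw [hT.sum_edges_of_face h]
    norm_num
  rw [h3] at h
  simp only [Finset.sum_const, nsmul_eq_mul, mul_one] at h
  omega

theorem orientable (hT : OrientedTriangles T) : Orientable (faces T) := by
  have next : ∀ (f : Finset V) (v : V), ∃ w, ∀ b c, T v b c → f = {v, b, c} → w = b := by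
    intro f v
    by_cases h : ∃ b c, T v b c ∧ f = {v, b, c}
    · obtain ⟨b, c, h, rfl⟩ := h
      exact ⟨b, fun b' c' h' e => (hT.eq_of_face_eq h h' e).1⟩
    · exact ⟨v, fun b c h1 h2 => absurd ⟨b, c, h1, h2⟩ h⟩
  choose o ho using next
  refine ⟨o, fun f hf v hv => ?_, fun f hf g hg hfg u w huf hwf hug hwg he => ?_⟩
  · obtain ⟨b, c, h, rfl⟩ := hT.exists_of_mem_face hf hv
    rw [ho _ _ _ _ h rfl, ho _ _ _ _ (hT.rotate h) (by ext; simp; tauto)]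
    exact ⟨by simp, (hT.ne h).symm, hT.ne_outer h⟩
  · obtain ⟨b, c, h, rfl⟩ := hT.exists_of_mem_face hf huf
    obtain rfl : b = w := by rw [← he, ho _ _ _ _ h rfl]
    obtain ⟨x, y, h', rfl⟩ := hT.exists_of_mem_face hg hwg
    simp only [Finset.mem_insert, Finset.mem_singleton] at hug
    rcases hug with rfl | rfl | rfl
    · exact absurd rfl (hT.ne h)
    · exact ho _ _ _ _ h' rfl
    · refine absurd ?_ hfg
      rw [hT.apex_unique h (hT.rotate (hT.rotate h'))]
      ext; simp; tauto

theorem exists_face_list (hT : OrientedTriangles T) {v : V} {L : List V} (hL : IsLink T v L) :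
    ∃ (l : List (Finset V)) (h : l ≠ []), l.length = L.length ∧ l.Nodup ∧
      (∀ f, f ∈ l ↔ f ∈ faces T ∧ v ∈ f) ∧ l.IsChain (SharesEdgeAt v) ∧
      SharesEdgeAt v (l.getLast h) (l.head h) := by
  have next : ∀ a, ∃ c, ∀ b, T v a b → c = b := by
    intro a
    by_cases h : ∃ b, T v a b
    · obtain ⟨b, h⟩ := h
      exact ⟨b, fun b' h' => hT.apex_unique h h'⟩
    · exact ⟨a, fun b h' => absurd ⟨b, h'⟩ h⟩
  choose r hr using next
  have hr' : ∀ {a}, a ∈ L → T v a (r a) := fun ha => by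
    obtain ⟨c, hc⟩ := hL.exists_next ha
    rwa [hr _ _ hc]
  have share : ∀ a b, T v a b → SharesEdgeAt v {v, a, r a} {v, b, r b} := by
    intro a b h
    obtain ⟨d, hd⟩ := hT.opposite (hT.rotate (hT.rotate h))
    rw [hr _ _ h, hr _ _ hd]
    refine ⟨fun e => ?_, b, hT.ne_outer h, by simp, by simp⟩
    exact hT.ne_right h (hT.eq_of_face_eq h hd e).1
  refine ⟨L.map fun a => {v, a, r a}, by simpa using hL.ne_nil, by simp, ?_, ?_, ?_, ?_⟩
  · refine (List.nodup_map_iff_inj_on hL.nodup).2 fun a ha b hb e => ?_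
    exact (hT.eq_of_face_eq (hr' ha) (hr' hb) e).1
  · intro f
    rw [List.mem_map]
    constructor
    · rintro ⟨a, ha, rfl⟩
      exact ⟨mem_faces.2 ⟨_, _, _, hr' ha, rfl⟩, by simp⟩
    · rintro ⟨hf, hv⟩
      obtain ⟨b, c, h, rfl⟩ := hT.exists_of_mem_face hf hv
      exact ⟨b, hL.complete h, by rw [hr _ _ h]⟩
  · exact (List.isChain_map _).2 (hL.chain.imp fun a b => share a b)
  · rw [List.getLast_map, List.head_map]
    exact share _ _ hL.close

theorem linkIsCycle (hT : OrientedTriangles T) {v : V} {L : List V} (hL : IsLink T v L) :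
    LinkIsCycle (faces T) v := by
  obtain ⟨l, h, -, h'⟩ := hT.exists_face_list hL
  exact ⟨l, h, h'⟩

theorem card_faces_at (hT : OrientedTriangles T) {v : V} {L : List V} (hL : IsLink T v L) :
    ((faces T).filter fun f => v ∈ f).card = L.length := by
  obtain ⟨l, -, hlen, hnd, hmem, -⟩ := hT.exists_face_list hL
  rw [← hlen, ← List.toFinset_card_of_nodup hnd]
  congr 1
  ext f
  simp [hmem]

theorem three_mul_card_faces (hT : OrientedTriangles T) {L : V → List V}
    (hL : ∀ v, IsLink T v (L v)) : 3 * (faces T).card = ∑ v, (L v).length := by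
  have h := Finset.sum_card_bipartiteAbove_eq_sum_card_bipartiteBelow
    (s := (Finset.univ : Finset V)) (t := faces T) (fun v f => v ∈ f)
  rw [Finset.sum_congr rfl (g := fun v => (L v).length)
    fun v _ => by rw [← hT.card_faces_at (hL v)]; rfl] at h
  rw [h, Finset.sum_congr rfl (g := fun _ => 3)]
  · simp [mul_comm]
  · intro f hf
    obtain ⟨a, b, c, h, rfl⟩ := mem_faces.1 hf
    rw [← hT.card_face h]
    congr 1
    ext x
    simp [Finset.mem_bipartiteBelow]

theorem isCombTriangulation (hT : OrientedTriangles T) {L : V → List V}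
    (hL : ∀ v, IsLink T v (L v))
    (hconn : (SimpleGraph.fromEdgeSet (↑(edges T) : Set (Sym2 V))).Connected) :
    IsCombTriangulation (edges T) (faces T) := by
  refine ⟨fun e he => ?_, hconn, fun f hf => ⟨?_, fun u hu v hv => ?_⟩, fun e he => ?_,
    fun v => hT.linkIsCycle (hL v)⟩
  · obtain ⟨a, b, c, h, rfl⟩ := mem_edges.1 he
    simpa using hT.ne h
  · obtain ⟨a, b, c, h, rfl⟩ := mem_faces.1 hf
    exact hT.card_face h
  · exact hT.sides_mem_edges hf hu hv
  · rw [← hT.card_faces_of_edge he]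

theorem two_mul_hamiltonian (hT : OrientedTriangles T) (σ : V → ℤ) :
    2 * Hamiltonian (edges T) σ =
      ∑ f ∈ faces T, ∑ e ∈ (edges T).filter (fun e => ∀ v ∈ e, v ∈ f), interaction σ e :=
  hT.two_mul_sum_edges (interaction σ)

theorem neg_one_le_face_energy (hT : OrientedTriangles T) {σ : V → ℤ} (hσ : IsSpin σ)
    {f : Finset V} (hf : f ∈ faces T) :
    -1 ≤ ∑ e ∈ (edges T).filter (fun e => ∀ v ∈ e, v ∈ f), interaction σ e := by
  obtain ⟨a, b, c, h, rfl⟩ := mem_faces.1 hf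
  rw [hT.sum_edges_of_face h]
  rcases hσ a with ha | ha <;> rcases hσ b with hb | hb <;> rcases hσ c with hc | hc <;>
    simp [interaction, ha, hb, hc]

theorem neg_card_faces_le (hT : OrientedTriangles T) {σ : V → ℤ} (hσ : IsSpin σ) :
    -((faces T).card : ℤ) ≤ 2 * Hamiltonian (edges T) σ := by
  rw [hT.two_mul_hamiltonian]
  simpa using Finset.card_nsmul_le_sum (faces T) _ (-1 : ℤ)
    fun f hf => hT.neg_one_le_face_energy hσ hf

theorem isProper_iff (hT : OrientedTriangles T) {σ : V → ℤ} (hσ : IsSpin σ) :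
    IsProper T σ ↔ 2 * Hamiltonian (edges T) σ = -((faces T).card : ℤ) := by
  have hc : -((faces T).card : ℤ) = ∑ _f ∈ faces T, (-1 : ℤ) := by simp
  rw [hT.two_mul_hamiltonian, hc, eq_comm,
    Finset.sum_eq_sum_iff_of_le fun f hf => hT.neg_one_le_face_energy hσ hf]
  have energy : ∀ {a b c}, T a b c → (¬ (σ a = σ b ∧ σ b = σ c) ↔
      -1 = ∑ e ∈ (edges T).filter (fun e => ∀ v ∈ e, v ∈ ({a, b, c} : Finset V)),
        interaction σ e) := by
    intro a b c h
    rw [hT.sum_edges_of_face h]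
    rcases hσ a with ha | ha <;> rcases hσ b with hb | hb <;> rcases hσ c with hc | hc <;>
      simp [interaction, ha, hb, hc]
  constructor
  · intro h f hf
    obtain ⟨a, b, c, h', rfl⟩ := mem_faces.1 hf
    exact (energy h').1 (h a b c h')
  · intro h a b c h'
    exact (energy h').2 (h _ (mem_faces.2 ⟨a, b, c, h', rfl⟩))

theorem groundstate_iff (hT : OrientedTriangles T) {σ τ : V → ℤ} (hσ : IsSpin σ)
    (hproper : IsProper T σ) :
    (IsSpin τ ∧ ∀ ρ : V → ℤ, IsSpin ρ → Hamiltonian (edges T) τ ≤ Hamiltonian (edges T) ρ) ↔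
      IsSpin τ ∧ IsProper T τ := by
  refine and_congr_right fun hτ => ?_
  have h0 := (hT.isProper_iff hσ).1 hproper
  rw [hT.isProper_iff hτ]
  constructor
  · intro h
    have h1 := h σ hσ
    have h2 := hT.neg_card_faces_le hτ
    omega
  · intro h ρ hρ
    have := hT.neg_card_faces_le hρ
    omega

end Faces

end OrientedTriangles

/-- The pullback of a ternary relation on `ℕ` to `Fin m`. -/
def restrict (m : ℕ) (T : ℕ → ℕ → ℕ → Prop) (a b c : Fin m) : Prop :=
  T a b c

theorem OrientedTriangles.restrict {m : ℕ} {T : ℕ → ℕ → ℕ → Prop} (hT : OrientedTriangles T)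
    (hm : ∀ {a b c}, T a b c → a < m) : OrientedTriangles (restrict m T) where
  rotate h := hT.rotate h
  apex_unique h h' := Fin.ext (hT.apex_unique h h')
  opposite h := by
    obtain ⟨d, hd⟩ := hT.opposite h
    exact ⟨⟨d, hm (hT.rotate (hT.rotate hd))⟩, hd⟩
  ne h e := hT.ne h (congrArg Fin.val e)
  not_swap h h' := hT.not_swap h h'

theorem IsLink.exists_restrict {m : ℕ} {T : ℕ → ℕ → ℕ → Prop} (hT : OrientedTriangles T)
    (hm : ∀ {a b c}, T a b c → a < m) {v : Fin m} {L : List ℕ} (hL : IsLink T v L) :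
    ∃ L' : List (Fin m), L'.length = L.length ∧ IsLink (restrict m T) v L' := by
  have lt : ∀ a ∈ L, a < m := fun a ha => by
    obtain ⟨c, hc⟩ := hL.exists_next ha
    exact hm (hT.rotate hc)
  lift L to List (Fin m) using lt
  refine ⟨L, by simp, by simpa using hL.ne_nil, hL.nodup.of_map _,
    (List.isChain_map Fin.val).1 hL.chain,
    ?_, fun h => ?_⟩
  · have := hL.close
    rwa [List.getLast_map, List.head_map] at this
  · obtain ⟨x, hx, e⟩ := List.mem_map.1 (hL.complete h)
    rwa [← Fin.ext e]

/-- Fourteen oriented triangles on the vertices `0, …, 7`, forming a torus with one quadrangular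
hole `0, 6, 1, 7`. -/
def coreTriangles : List (ℕ × ℕ × ℕ) :=
  [(0, 6, 2), (7, 2, 1), (2, 6, 3), (2, 3, 1), (1, 4, 5), (6, 1, 5), (1, 3, 0), (1, 0, 4),
    (3, 4, 7), (3, 7, 0), (4, 0, 2), (4, 2, 7), (4, 3, 5), (3, 6, 5)]

/-- The triangles of the core, each listed from all of its three corners. -/
def coreCorners : List (ℕ × ℕ × ℕ) :=
  coreTriangles.flatMap fun (a, b, c) => [(a, b, c), (b, c, a), (c, a, b)]

/-- `b` follows `a` on the path `7, 8, …, k + 7, 6`. -/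
def PathSucc (k a b : ℕ) : Prop :=
  7 ≤ a ∧ a < k + 7 ∧ b = a + 1 ∨ a = k + 7 ∧ b = 6

/-- The triangles joining an edge of the path to `0` or to `1`; they fill the hole of the core. -/
def PathTriangle (k a b c : ℕ) : Prop :=
  c = 0 ∧ PathSucc k a b ∨ c = 1 ∧ PathSucc k b a

/-- The oriented triangles of a torus with vertices `0, …, k + 7`. -/
def TorusTriangle (k a b c : ℕ) : Prop :=
  (a, b, c) ∈ coreCorners ∨ PathTriangle k a b c ∨ PathTriangle k b c a ∨ PathTriangle k c a b

theorem coreCorners_rotate :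
    ∀ t ∈ coreCorners, (t.2.1, t.2.2, t.1) ∈ coreCorners := by decide

theorem coreCorners_apex_unique :
    ∀ t ∈ coreCorners, ∀ t' ∈ coreCorners, t.1 = t'.1 → t.2.1 = t'.2.1 → t.2.2 = t'.2.2 := by
  decide +kernel

theorem coreCorners_lt : ∀ t ∈ coreCorners, t.1 < 8 ∧ t.2.1 < 8 ∧ t.1 ≠ t.2.1 := by decide

theorem coreCorners_swap :
    ∀ t ∈ coreCorners, (t.2.1, t.1, t.2.2) ∉ coreCorners := by decide +kernel

theorem coreCorners_opposite :
    ∀ t ∈ coreCorners, (t.1, t.2.1) ∈ [(0, 6), (7, 0), (6, 1), (1, 7)] ∨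
      ∃ d, (t.2.1, t.1, d) ∈ coreCorners := by
  have key : ∀ t ∈ coreCorners, (t.1, t.2.1) ∈ [(0, 6), (7, 0), (6, 1), (1, 7)] ∨
      ∃ d < 8, (t.2.1, t.1, d) ∈ coreCorners := by decide +kernel
  exact fun t ht => (key t ht).imp_right fun ⟨d, _, hd⟩ => ⟨d, hd⟩

theorem coreCorners_boundary :
    ∀ t ∈ coreCorners, (t.1, t.2.1) ∉ [(6, 0), (0, 7), (7, 1), (1, 6)] := by decide

theorem torusTriangle_lt {k a b c : ℕ} (h : TorusTriangle k a b c) : a < k + 8 := by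
  rcases h with h | h
  · have := (coreCorners_lt _ h).1
    dsimp only at this
    omega
  · unfold PathTriangle PathSucc at h
    omega

theorem torusTriangle_rotate {k a b c : ℕ} (h : TorusTriangle k a b c) :
    TorusTriangle k b c a := by
  rcases h with h | h | h | h
  · exact Or.inl (coreCorners_rotate _ h)
  · exact Or.inr (Or.inr (Or.inr h))
  · exact Or.inr (Or.inl h)
  · exact Or.inr (Or.inr (Or.inl h))

namespace PathSucc

variable {k a b : ℕ}

theorem triangle_zero (h : PathSucc k a b) : TorusTriangle k a b 0 :=
  Or.inr (Or.inl (Or.inl ⟨rfl, h⟩))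

theorem triangle_one (h : PathSucc k a b) : TorusTriangle k b a 1 :=
  Or.inr (Or.inl (Or.inr ⟨rfl, h⟩))

theorem exists_next (h : PathSucc k a b) : b = 6 ∨ ∃ c, PathSucc k b c := by
  unfold PathSucc at *
  by_cases hb : b = 6
  · exact Or.inl hb
  · by_cases hb' : b = k + 7
    · exact Or.inr ⟨6, by omega⟩
    · exact Or.inr ⟨b + 1, by omega⟩

theorem exists_prev (h : PathSucc k a b) : a = 7 ∨ ∃ c, PathSucc k c a := by
  unfold PathSucc at *
  by_cases ha : a = 7
  · exact Or.inl ha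
  · exact Or.inr ⟨a - 1, by omega⟩

end PathSucc

theorem torusTriangle_opposite {k a b c : ℕ} (hk : 1 ≤ k) (h : TorusTriangle k a b c) :
    ∃ d, TorusTriangle k b a d := by
  have last : PathSucc k (k + 7) 6 := Or.inr ⟨rfl, rfl⟩
  have first : PathSucc k 7 8 := Or.inl (by omega)
  rcases h with h | (⟨rfl, h⟩ | ⟨rfl, h⟩) | (⟨rfl, h⟩ | ⟨rfl, h⟩) | (⟨rfl, h⟩ | ⟨rfl, h⟩)
  · rcases coreCorners_opposite _ h with h | ⟨d, h⟩
    · simp only [List.mem_cons, Prod.mk.injEq, List.not_mem_nil, or_false] at h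
      rcases h with ⟨rfl, rfl⟩ | ⟨rfl, rfl⟩ | ⟨rfl, rfl⟩ | ⟨rfl, rfl⟩
      · exact ⟨_, torusTriangle_rotate last.triangle_zero⟩
      · exact ⟨_, torusTriangle_rotate (torusTriangle_rotate first.triangle_zero)⟩
      · exact ⟨_, torusTriangle_rotate (torusTriangle_rotate last.triangle_one)⟩
      · exact ⟨_, torusTriangle_rotate first.triangle_one⟩
    · exact ⟨d, Or.inl h⟩
  · exact ⟨_, h.triangle_one⟩
  · exact ⟨_, h.triangle_zero⟩
  · rcases h.exists_prev with rfl | ⟨x, h'⟩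
    · exact ⟨3, Or.inl (by decide)⟩
    · exact ⟨_, torusTriangle_rotate h'.triangle_zero⟩
  · rcases h.exists_next with rfl | ⟨x, h'⟩
    · exact ⟨5, Or.inl (by decide)⟩
    · exact ⟨_, torusTriangle_rotate h'.triangle_one⟩
  · rcases h.exists_next with rfl | ⟨x, h'⟩
    · exact ⟨2, Or.inl (by decide)⟩
    · exact ⟨_, torusTriangle_rotate (torusTriangle_rotate h'.triangle_zero)⟩
  · rcases h.exists_prev with rfl | ⟨x, h'⟩
    · exact ⟨2, Or.inl (by decide)⟩
    · exact ⟨_, torusTriangle_rotate (torusTriangle_rotate h'.triangle_one)⟩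

theorem orientedTriangles_torusTriangle {k : ℕ} (hk : 1 ≤ k) :
    OrientedTriangles (TorusTriangle k) where
  rotate := torusTriangle_rotate
  apex_unique {a b c d} h h' := by
    rcases h with h | h <;> rcases h' with h' | h'
    · exact coreCorners_apex_unique _ h _ h' rfl rfl
    · have h1 := coreCorners_lt _ h
      have h2 := coreCorners_boundary _ h
      simp at h1 h2
      unfold PathTriangle PathSucc at h'
      omega
    · have h1 := coreCorners_lt _ h'
      have h2 := coreCorners_boundary _ h'
      simp at h1 h2
      unfold PathTriangle PathSucc at h
      omega
    · unfold PathTriangle PathSucc at h h'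
      omega
  opposite := torusTriangle_opposite hk
  ne {a b c} h := by
    rcases h with h | h
    · exact (coreCorners_lt _ h).2.2
    · unfold PathTriangle PathSucc at h
      omega
  not_swap {a b c} h h' := by
    rcases h with h | h <;> rcases h' with h' | h'
    · exact coreCorners_swap _ h h'
    · have h1 := coreCorners_lt _ h
      have h2 := coreCorners_lt _ (coreCorners_rotate _ h)
      simp at h1 h2
      unfold PathTriangle PathSucc at h'
      omega
    · have h1 := coreCorners_lt _ h'
      have h2 := coreCorners_lt _ (coreCorners_rotate _ h')
      simp at h1 h2
      unfold PathTriangle PathSucc at h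
      omega
    · unfold PathTriangle PathSucc at h' h
      omega

/-- The cyclic order of the neighbours of a vertex. -/
def link (k : ℕ) : ℕ → List ℕ
  | 0 => [6, 2, 4, 1, 3] ++ List.range' 7 (k + 1)
  | 1 => [2, 3, 0, 4, 5, 6] ++ (List.range' 7 (k + 1)).reverse
  | 2 => [0, 6, 3, 1, 7, 4]
  | 3 => [2, 6, 5, 4, 7, 0, 1]
  | 4 => [5, 1, 0, 2, 7, 3]
  | 5 => [1, 4, 3, 6]
  | 6 => [2, 0, k + 7, 1, 5, 3]
  | 7 => [2, 1, 8, 0, 3, 4]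
  | i + 8 => [0, i + 7, 1, if i + 1 < k then i + 9 else 6]

theorem sum_length_link (k : ℕ) : ∑ v : Fin (k + 8), (link k v).length = 6 * (k + 8) := by
  rw [Fin.sum_univ_eq_sum_range (fun v => (link k v).length)]
  simp [Finset.sum_range_succ', link]
  omega

theorem isChain_torusTriangle {k v : ℕ} {l : List ℕ}
    (h : l.IsChain fun a b => (v, a, b) ∈ coreCorners) : l.IsChain (TorusTriangle k v) :=
  h.imp fun _ _ => Or.inl

theorem isLink_zero {k : ℕ} : IsLink (TorusTriangle k) 0 (link k 0) := by
  have last : PathSucc k (k + 7) 6 := Or.inr ⟨rfl, rfl⟩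
  refine ⟨by simp [link], by simp [link, List.nodup_range'], ?_, ?_, fun {a c} h => ?_⟩
  · rw [link, List.isChain_append]
    refine ⟨isChain_torusTriangle (by decide), List.isChain_iff_getElem.2 fun i hi => ?_, ?_⟩
    · simp only [List.length_range', List.getElem_range', one_mul] at hi ⊢
      exact torusTriangle_rotate (torusTriangle_rotate (PathSucc.triangle_zero (Or.inl (by omega))))
    · have : TorusTriangle k 0 3 7 := Or.inl (by decide)
      simpa [List.range'_succ] using this
  · have := torusTriangle_rotate (torusTriangle_rotate last.triangle_zero)
    simpa [link, add_comm] using this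
  · have key : ∀ t ∈ coreCorners, t.1 = 0 → t.2.1 ∈ [6, 2, 4, 1, 3, 7] := by decide
    rcases h with h | h
    · have := key _ h rfl
      simp [link] at this ⊢
      omega
    · unfold PathTriangle PathSucc at h
      simp [link]
      omega

theorem isLink_one {k : ℕ} : IsLink (TorusTriangle k) 1 (link k 1) := by
  have last : PathSucc k (k + 7) 6 := Or.inr ⟨rfl, rfl⟩
  refine ⟨by simp [link], by simp [link, List.nodup_range'], ?_, ?_, fun {a c} h => ?_⟩
  · rw [link, List.isChain_append, List.isChain_reverse]
    refine ⟨isChain_torusTriangle (by decide), List.isChain_iff_getElem.2 fun i hi => ?_, ?_⟩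
    · simp only [List.length_range', List.getElem_range', one_mul] at hi ⊢
      exact torusTriangle_rotate (torusTriangle_rotate (PathSucc.triangle_one (Or.inl (by omega))))
    · have := torusTriangle_rotate (torusTriangle_rotate last.triangle_one)
      simpa [List.getLast?_range', add_comm] using this
  · have : TorusTriangle k 1 7 2 := Or.inl (by decide)
    simpa [link] using this
  · have key : ∀ t ∈ coreCorners, t.1 = 1 → t.2.1 ∈ [2, 3, 0, 4, 5, 6, 7] := by decide
    rcases h with h | h
    · have := key _ h rfl
      simp [link] at this ⊢
      omega
    · unfold PathTriangle PathSucc at h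
      simp [link]
      omega

/-- A vertex of the core that is not on its boundary. -/
theorem isLink_core {k v : ℕ} {L : List ℕ} (hv : 2 ≤ v ∧ v ≤ 5) (hne : L ≠ []) (hnd : L.Nodup)
    (hchain : L.IsChain fun a b => (v, a, b) ∈ coreCorners)
    (hclose : (v, L.getLast hne, L.head hne) ∈ coreCorners)
    (hmem : ∀ t ∈ coreCorners, t.1 = v → t.2.1 ∈ L) : IsLink (TorusTriangle k) v L := by
  refine ⟨hne, hnd, isChain_torusTriangle hchain, Or.inl hclose, fun {a c} h => ?_⟩
  rcases h with h | h
  · exact hmem _ h rfl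
  · unfold PathTriangle PathSucc at h
    omega

theorem isLink_six {k : ℕ} : IsLink (TorusTriangle k) 6 (link k 6) := by
  have last : PathSucc k (k + 7) 6 := Or.inr ⟨rfl, rfl⟩
  refine ⟨by simp [link], by simp [link], ?_,
    Or.inl (show (6, 3, 2) ∈ coreCorners by decide), fun {a c} h => ?_⟩
  · simp only [link, List.isChain_cons_cons, List.isChain_singleton, and_true]
    exact ⟨Or.inl (by decide), torusTriangle_rotate last.triangle_zero, last.triangle_one,
      Or.inl (by decide), Or.inl (by decide)⟩
  · have key : ∀ t ∈ coreCorners, t.1 = 6 → t.2.1 ∈ [2, 0, 1, 5, 3] := by decide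
    rcases h with h | h
    · have := key _ h rfl
      simp [link] at this ⊢
      omega
    · unfold PathTriangle PathSucc at h
      simp [link]
      omega

theorem isLink_seven {k : ℕ} (hk : 1 ≤ k) : IsLink (TorusTriangle k) 7 (link k 7) := by
  have first : PathSucc k 7 8 := Or.inl (by omega)
  refine ⟨by simp [link], by simp [link], ?_,
    Or.inl (show (7, 4, 2) ∈ coreCorners by decide), fun {a c} h => ?_⟩
  · simp only [link, List.isChain_cons_cons, List.isChain_singleton, and_true]
    exact ⟨Or.inl (by decide), torusTriangle_rotate first.triangle_one, first.triangle_zero,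
      Or.inl (by decide), Or.inl (by decide)⟩
  · have key : ∀ t ∈ coreCorners, t.1 = 7 → t.2.1 ∈ [2, 1, 0, 3, 4] := by decide
    rcases h with h | h
    · have := key _ h rfl
      simp [link] at this ⊢
      omega
    · unfold PathTriangle PathSucc at h
      simp [link]
      omega

theorem isLink_path {k i : ℕ} (hi : i < k) : IsLink (TorusTriangle k) (i + 8) (link k (i + 8)) := by
  obtain ⟨s, hs⟩ : ∃ s, s = if i + 1 < k then i + 9 else 6 := ⟨_, rfl⟩
  have prev : PathSucc k (i + 7) (i + 8) := Or.inl (by omega)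
  have next : PathSucc k (i + 8) s := by unfold PathSucc; split_ifs at hs <;> omega
  have hne : s ≠ 0 ∧ s ≠ 1 ∧ s ≠ i + 7 := by split_ifs at hs <;> omega
  rw [link, ← hs]
  refine ⟨by simp, ?_, ?_, next.triangle_zero, fun {a c} h => ?_⟩
  · simp; omega
  · simp only [List.isChain_cons_cons, List.isChain_singleton, and_true]
    exact ⟨torusTriangle_rotate prev.triangle_zero, prev.triangle_one,
      torusTriangle_rotate next.triangle_one⟩
  · rcases h with h | h
    · have := (coreCorners_lt _ h).1
      dsimp only at this
      omega
    · unfold PathTriangle PathSucc at h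
      simp
      split_ifs at hs <;> omega

theorem isLink_link {k v : ℕ} (hk : 1 ≤ k) (hv : v < k + 8) :
    IsLink (TorusTriangle k) v (link k v) := by
  match v with
  | 0 => exact isLink_zero
  | 1 => exact isLink_one
  | 2 | 3 | 4 | 5 =>
    simp only [link]
    exact isLink_core (by omega) (by simp) (by decide) (by decide) (by decide) (by decide)
  | 6 => exact isLink_six
  | 7 => exact isLink_seven hk
  | i + 8 => exact isLink_path (by omega)

/-- The groundstate: six spins on the core, then alternating spins along the path. -/
def groundSpin : ℕ → ℤ
  | 0 | 2 | 5 => 1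
  | 1 | 3 | 4 => -1
  | i + 6 => -(-1) ^ i

theorem isSpin_groundSpin : IsSpin groundSpin := by
  intro v
  unfold groundSpin
  split <;> try simp
  rename_i i
  rcases neg_one_pow_eq_or ℤ i with h | h <;> simp [h]

theorem PathSucc.groundSpin_ne {k a b : ℕ} (hk : Even k) (h : PathSucc k a b) :
    groundSpin a ≠ groundSpin b := by
  rcases h with ⟨h7, -, rfl⟩ | ⟨rfl, rfl⟩
  · obtain ⟨j, rfl⟩ := Nat.exists_eq_add_of_le' h7
    have := isSpin_groundSpin (j + 7)
    have e : groundSpin (j + 7 + 1) = -groundSpin (j + 7) := by simp [groundSpin, pow_succ]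
    omega
  · simp [groundSpin, pow_succ, hk.neg_one_pow]

theorem isProper_groundSpin {k : ℕ} (hk : Even k) :
    IsProper (TorusTriangle k) groundSpin := by
  have key : ∀ t ∈ coreCorners,
      ¬ (groundSpin t.1 = groundSpin t.2.1 ∧ groundSpin t.2.1 = groundSpin t.2.2) := by decide
  intro a b c h
  rcases h with h | (⟨rfl, h⟩ | ⟨rfl, h⟩) | (⟨rfl, h⟩ | ⟨rfl, h⟩) | (⟨rfl, h⟩ | ⟨rfl, h⟩)
  · exact key _ h
  all_goals
    have := h.groundSpin_ne hk
    grind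

theorem core_forced {σ : ℕ → ℤ} (hσ : IsSpin σ)
    (h : ∀ t ∈ coreTriangles, ¬ (σ t.1 = σ t.2.1 ∧ σ t.2.1 = σ t.2.2)) :
    σ 1 = -σ 0 ∧ (σ 6 ≠ σ 7 → ∀ v < 8, σ v = σ 0 * groundSpin v) := by
  have h0 := hσ 0
  have h1 := hσ 1
  have h2 := hσ 2
  have h3 := hσ 3
  have h4 := hσ 4
  have h5 := hσ 5
  have h6 := hσ 6
  have h7 := hσ 7
  simp only [coreTriangles, List.forall_mem_cons] at h
  obtain ⟨g1, g2, g3, g4, g5, g6, g7, g8, g9, g10, g11, g12, g13, g14, -⟩ := h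
  refine ⟨by grind (splits := 20), fun h v hv => ?_⟩
  interval_cases v <;> simp [groundSpin] <;> grind (splits := 20)

theorem eq_mul_groundSpin {k : ℕ} (hk : Even k) {σ : ℕ → ℤ} (hσ : IsSpin σ)
    (h : IsProper (TorusTriangle k) σ) {v : ℕ} (hv : v < k + 8) : σ v = σ 0 * groundSpin v := by
  have hcore := core_forced hσ fun t ht => h _ _ _ (Or.inl (List.mem_flatMap.2 ⟨t, ht, by simp⟩))
  have alt : ∀ {a b}, PathSucc k a b → σ b = -σ a := by
    intro a b hab
    have g0 := h _ _ _ hab.triangle_zero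
    have g1 := h _ _ _ hab.triangle_one
    have := hσ 0
    have := hσ a
    have := hσ b
    omega
  have path : ∀ i ≤ k, σ (i + 7) = (-1) ^ i * σ 7 := by
    intro i hi
    induction i with
    | zero => simp
    | succ i ih =>
      rw [alt (a := i + 7) (Or.inl (by omega)), ih (by omega)]
      ring
  have h67 : σ 6 ≠ σ 7 := by
    have h6 := alt (a := k + 7) (b := 6) (Or.inr ⟨rfl, rfl⟩)
    rw [path k le_rfl, hk.neg_one_pow] at h6
    have := hσ 7
    omega
  have h8 := hcore.2 h67
  by_cases hv8 : v < 8
  · exact h8 v hv8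
  · obtain ⟨i, rfl⟩ := Nat.exists_eq_add_of_le' (show 7 ≤ v by omega)
    rw [path i (by omega), h8 7 (by omega)]
    simp [groundSpin, pow_succ]
    ring

theorem connected_edges {k : ℕ} (hk : 1 ≤ k) :
    (SimpleGraph.fromEdgeSet
      (↑(edges (restrict (k + 8) (TorusTriangle k))) : Set (Sym2 (Fin (k + 8))))).Connected := by
  have hT := (orientedTriangles_torusTriangle hk).restrict (m := k + 8) torusTriangle_lt
  have adj : ∀ {a b c : ℕ} (h : TorusTriangle k a b c), (SimpleGraph.fromEdgeSet
      (↑(edges (restrict (k + 8) (TorusTriangle k))) : Set (Sym2 (Fin (k + 8))))).Reachable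
      ⟨a, torusTriangle_lt h⟩ ⟨b, torusTriangle_lt (torusTriangle_rotate h)⟩ := by
    intro a b c h
    have h' : restrict (k + 8) (TorusTriangle k) ⟨a, torusTriangle_lt h⟩
      ⟨b, torusTriangle_lt (torusTriangle_rotate h)⟩
      ⟨c, torusTriangle_lt (torusTriangle_rotate (torusTriangle_rotate h))⟩ := h
    exact SimpleGraph.Adj.reachable
      ((SimpleGraph.fromEdgeSet_adj _).2 ⟨hT.mk_mem_edges.2 ⟨_, h'⟩, hT.ne h'⟩)
  have core : ∀ {a b c}, (a, b, c) ∈ coreCorners → TorusTriangle k a b c := Or.inl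
  refine (SimpleGraph.connected_iff_exists_forall_reachable _).2
    ⟨⟨0, by omega⟩, fun ⟨v, hv⟩ => ?_⟩
  match v with
  | 0 => exact SimpleGraph.Reachable.refl _
  | 1 => exact adj (core (c := 3) (by decide))
  | 2 => exact adj (core (c := 4) (by decide))
  | 3 => exact adj (core (c := 7) (by decide))
  | 4 => exact adj (core (c := 1) (by decide))
  | 5 =>
    exact (adj (core (a := 0) (b := 4) (c := 1) (by decide))).trans
      (adj (core (c := 1) (by decide)))
  | 6 => exact adj (core (c := 2) (by decide))
  | i + 7 =>
    obtain ⟨s, hs⟩ : ∃ s, PathSucc k (i + 7) s := by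
      unfold PathSucc
      by_cases h : i = k
      · exact ⟨6, by omega⟩
      · exact ⟨i + 8, by omega⟩
    exact adj (torusTriangle_rotate (torusTriangle_rotate hs.triangle_zero))

/-- For every natural number `n` there is a combinatorial triangulation of the torus
(orientable, Euler characteristic `0`) with at least `n` vertices on which the
antiferromagnetic Ising model has a non-degenerate groundstate: there is a spin assignment
`σ` such that the minimizers of the Hamiltonian are exactly `σ` and `-σ`. -/
theorem torus_triangulation_with_nondegenerate_groundstate (n : ℕ) :
    ∃ (m : ℕ) (E : Finset (Sym2 (Fin m))) (F : Finset (Finset (Fin m))),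
      n ≤ m ∧
      IsCombTriangulation E F ∧
      Orientable F ∧
      (m : ℤ) - (E.card : ℤ) + (F.card : ℤ) = 0 ∧
      ∃ σ : Fin m → ℤ, IsSpin σ ∧
        ∀ τ : Fin m → ℤ,
          ((IsSpin τ ∧ ∀ ρ : Fin m → ℤ, IsSpin ρ → Hamiltonian E τ ≤ Hamiltonian E ρ)
            ↔ (τ = σ ∨ τ = -σ)) := by
  obtain ⟨k, hk, hk1, hnk⟩ : ∃ k, Even k ∧ 1 ≤ k ∧ n ≤ k :=
    ⟨2 * (n + 1), even_two_mul _, by omega, by omega⟩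
  have hT' := orientedTriangles_torusTriangle hk1
  have hT := hT'.restrict (m := k + 8) torusTriangle_lt
  choose L hlen hL using fun v : Fin (k + 8) =>
    (isLink_link hk1 v.2).exists_restrict hT' torusTriangle_lt
  have hF := hT.three_mul_card_faces hL
  simp only [hlen, sum_length_link] at hF
  have hE := hT.two_mul_card_edges
  have hσ : IsSpin fun v : Fin (k + 8) => groundSpin v := fun v => isSpin_groundSpin v
  have hproper : IsProper (restrict (k + 8) (TorusTriangle k)) fun v => groundSpin v :=
    fun a b c h => isProper_groundSpin hk a b c h
  refine ⟨k + 8, edges (restrict (k + 8) (TorusTriangle k)),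
    faces (restrict (k + 8) (TorusTriangle k)), by omega,
    hT.isCombTriangulation hL (connected_edges hk1), hT.orientable, by push_cast; omega,
    fun v => groundSpin v, hσ, fun τ => ?_⟩
  rw [hT.groundstate_iff hσ hproper]
  constructor
  · rintro ⟨hτ, hτp⟩
    let t : ℕ → ℤ := fun v => if h : v < k + 8 then τ ⟨v, h⟩ else 1
    have ht : ∀ v : Fin (k + 8), t v = τ v := fun v => by simp [t]
    have hspin : IsSpin t := fun v => by
      by_cases h : v < k + 8
      · rw [ht ⟨v, h⟩]
        exact hτ _
      · simp [t, h]
    have htp : IsProper (TorusTriangle k) t := fun a b c h => by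
      have ha := torusTriangle_lt h
      have hb := torusTriangle_lt (torusTriangle_rotate h)
      have hc := torusTriangle_lt (torusTriangle_rotate (torusTriangle_rotate h))
      rw [ht ⟨a, ha⟩, ht ⟨b, hb⟩, ht ⟨c, hc⟩]
      exact hτp _ _ _ h
    have key : ∀ v, τ v = t 0 * groundSpin v := fun v => by
      rw [← ht, eq_mul_groundSpin hk hspin htp v.2]
    rcases hspin 0 with h | h
    · exact Or.inl (funext fun v => by simp [key v, h])
    · exact Or.inr (funext fun v => by simp [key v, h])
  · rintro (rfl | rfl)
    · exact ⟨hσ, hproper⟩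
    · refine ⟨fun v => ?_, fun a b c h => ?_⟩
      · rcases isSpin_groundSpin v with h | h <;> simp [h]
      · simpa using hproper a b c h
end

section
/- For every integer g ≥ 1 and every natural number n there exists an orientable combinatorial triangulation of a closed surface with Euler characteristic 2 − 2g (a finite simple connected graph G = (V,E) with face family F as below) such that |V| ≥ n and the antiferromagnetic Ising model on it has a non-degenerate groundstate, i.e., there is a spin assignment σ* : V → {−1,+1} such that the set of minimizers of H is exactly {σ*, −σ*}. -/
open scoped Classical

/-- The cyclically consecutive pairs of a list. -/
def List.cyclicPairs {α : Type*} (l : List α) : List (α × α) := l.zip (l.rotate 1)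

section CyclicPairs

variable {α β : Type*}

theorem List.length_cyclicPairs (l : List α) : l.cyclicPairs.length = l.length := by
  simp [List.cyclicPairs]

theorem List.getElem_cyclicPairs (l : List α) (i : ℕ) (hi : i < l.cyclicPairs.length) :
    l.cyclicPairs[i] = (l[i]'(by simpa [List.length_cyclicPairs] using hi),
      l[(i + 1) % l.length]'(Nat.mod_lt _ (by
        have := l.length_cyclicPairs; omega))) := by
  simp [List.cyclicPairs, List.getElem_rotate]

theorem List.mem_cyclicPairs_iff {l : List α} {u w : α} :
    (u, w) ∈ l.cyclicPairs ↔
      ∃ (i : ℕ) (hi : i < l.length), l[i] = u ∧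
        l[(i + 1) % l.length]'(Nat.mod_lt _ (by omega)) = w := by
  rw [List.mem_iff_getElem]
  simp only [List.getElem_cyclicPairs, Prod.mk.injEq, List.length_cyclicPairs]

theorem List.cyclicPairs_rotate (l : List α) (n : ℕ) :
    (l.rotate n).cyclicPairs = l.cyclicPairs.rotate n := by
  rw [List.cyclicPairs, List.cyclicPairs, List.zip_eq_zipWith, List.zip_eq_zipWith,
    List.zipWith_rotate_distrib]
  · rw [List.rotate_rotate, List.rotate_rotate, Nat.add_comm]
  · simp

theorem List.IsRotated.mem_cyclicPairs_iff {l l' : List α} (h : l ~r l') {p : α × α} :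
    p ∈ l.cyclicPairs ↔ p ∈ l'.cyclicPairs := by
  obtain ⟨n, rfl⟩ := h
  rw [List.cyclicPairs_rotate, List.mem_rotate]

theorem List.cyclicPairs_map (f : α → β) (l : List α) :
    (l.map f).cyclicPairs = l.cyclicPairs.map (Prod.map f f) := by
  rw [List.cyclicPairs, List.cyclicPairs, ← List.map_rotate, List.zip_map]

theorem List.left_mem_of_mem_cyclicPairs {l : List α} {u w : α} (h : (u, w) ∈ l.cyclicPairs) :
    u ∈ l :=
  (List.of_mem_zip h).1

theorem List.right_mem_of_mem_cyclicPairs {l : List α} {u w : α} (h : (u, w) ∈ l.cyclicPairs) :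
    w ∈ l :=
  List.mem_rotate.1 (List.of_mem_zip h).2

theorem List.exists_mem_cyclicPairs_of_mem {l : List α} {u : α} (h : u ∈ l) :
    ∃ w, (u, w) ∈ l.cyclicPairs := by
  obtain ⟨i, hi, rfl⟩ := List.mem_iff_getElem.1 h
  exact ⟨_, List.mem_cyclicPairs_iff.2 ⟨i, hi, rfl, rfl⟩⟩

theorem List.Nodup.right_unique_of_mem_cyclicPairs {l : List α} (hl : l.Nodup) {u w w' : α}
    (h : (u, w) ∈ l.cyclicPairs) (h' : (u, w') ∈ l.cyclicPairs) : w = w' := by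
  obtain ⟨i, hi, rfl, rfl⟩ := List.mem_cyclicPairs_iff.1 h
  obtain ⟨j, hj, hij, rfl⟩ := List.mem_cyclicPairs_iff.1 h'
  obtain rfl := (hl.getElem_inj_iff).1 hij
  rfl

theorem List.Nodup.swap_not_mem_cyclicPairs {l : List α} (hl : l.Nodup) (h3 : 3 ≤ l.length)
    {u w : α} (h : (u, w) ∈ l.cyclicPairs) : (w, u) ∉ l.cyclicPairs := by
  intro h'
  obtain ⟨i, hi, rfl, rfl⟩ := List.mem_cyclicPairs_iff.1 h
  obtain ⟨j, hj, hij, hji⟩ := List.mem_cyclicPairs_iff.1 h'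
  have e1 := (hl.getElem_inj_iff).1 hij
  have e2 := (hl.getElem_inj_iff).1 hji
  have aux : ∀ k < l.length, (k + 1 < l.length ∧ (k + 1) % l.length = k + 1) ∨
      (k + 1 = l.length ∧ (k + 1) % l.length = 0) := by
    intro k hk
    rcases Nat.lt_or_ge (k + 1) l.length with h1 | h1
    · exact Or.inl ⟨h1, Nat.mod_eq_of_lt h1⟩
    · have : k + 1 = l.length := by omega
      exact Or.inr ⟨this, by rw [this, Nat.mod_self]⟩
  rcases aux i hi with ⟨_, q⟩ | ⟨_, q⟩ <;> rcases aux j hj with ⟨_, q'⟩ | ⟨_, q'⟩ <;> omega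

/-- Closing up an open path by the edge from its end to its start. -/
theorem List.cyclicPairs_cons_append_singleton (x y : α) (l : List α) :
    (x :: (l ++ [y])).cyclicPairs = (x :: l).zip (l ++ [y]) ++ [(y, x)] := by
  have : (x :: (l ++ [y])).cyclicPairs = ((x :: l) ++ [y]).zip ((l ++ [y]) ++ [x]) := by
    simp [List.cyclicPairs]
  rw [this, List.zip_append (by simp)]
  simp

theorem List.Nodup.mem_zip_iff {x y : α} {l : List α} (h : (x :: (l ++ [y])).Nodup)
    {p : α × α} :
    p ∈ (x :: l).zip (l ++ [y]) ↔ p ∈ (x :: (l ++ [y])).cyclicPairs ∧ p ≠ (y, x) := by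
  have : (y, x) ∉ (x :: l).zip (l ++ [y]) := fun hm =>
    (List.nodup_cons.1 h).1 (List.of_mem_zip hm).2
  rw [List.cyclicPairs_cons_append_singleton, List.mem_append, List.mem_singleton]
  constructor
  · intro hp
    exact ⟨Or.inl hp, fun he => this (he ▸ hp)⟩
  · rintro ⟨hp | hp, hne⟩
    · exact hp
    · exact absurd hp hne

/-- Joining two open paths with common endpoints into a cycle. -/
theorem List.cyclicPairs_join (x y : α) (l m : List α) :
    (x :: (l ++ y :: m)).cyclicPairs =
      (x :: l).zip (l ++ [y]) ++ (y :: m).zip (m ++ [x]) := by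
  rw [← List.zip_append (by simp)]
  simp [List.cyclicPairs]

/-- A cyclic sequence in which `w` follows `u` can be cut open between `u` and `w`. -/
theorem List.Nodup.exists_isRotated_of_mem_cyclicPairs {l : List α} (hl : l.Nodup)
    (h3 : 3 ≤ l.length) {u w : α} (h : (u, w) ∈ l.cyclicPairs) :
    ∃ m, l ~r w :: (m ++ [u]) := by
  obtain ⟨s, t, rfl⟩ := List.append_of_mem (List.left_mem_of_mem_cyclicPairs h)
  have hr : s ++ u :: t ~r u :: t ++ s := List.isRotated_append
  have h' := hr.mem_cyclicPairs_iff.1 h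
  have hn : (u :: t ++ s).Nodup := hr.nodup_iff.1 hl
  have hlen : 3 ≤ (u :: t ++ s).length := by simp at h3 ⊢; omega
  rw [List.cons_append] at h' hn hlen hr
  generalize t ++ s = r at *
  cases r with
  | nil => simp at hlen
  | cons z m =>
    have hz : (u, z) ∈ (u :: z :: m).cyclicPairs := by simp [List.cyclicPairs]
    obtain rfl := hn.right_unique_of_mem_cyclicPairs h' hz
    exact ⟨m, hr.trans ⟨1, by simp⟩⟩

end CyclicPairs

/-- A set `D` of oriented triples is the set of oriented faces of a closed oriented triangulated
surface: it is invariant under cyclic shifts and around each vertex the faces form one cycle. -/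
structure IsOrientedTriangulation {V : Type*} (D : Finset (V × V × V)) : Prop where
  shift : ∀ {v u w : V}, (v, u, w) ∈ D → (u, w, v) ∈ D
  link : ∀ v : V, ∃ l : List V, l.Nodup ∧ 3 ≤ l.length ∧
    ∀ u w : V, (v, u, w) ∈ D ↔ (u, w) ∈ l.cyclicPairs

namespace IsOrientedTriangulation

variable {V : Type*} {D : Finset (V × V × V)}

theorem unique (h : IsOrientedTriangulation D) {v u w w' : V} (h1 : (v, u, w) ∈ D)
    (h2 : (v, u, w') ∈ D) : w = w' := by
  obtain ⟨l, hl, -, hD⟩ := h.link v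
  exact hl.right_unique_of_mem_cyclicPairs ((hD _ _).1 h1) ((hD _ _).1 h2)

theorem swap_not_mem (h : IsOrientedTriangulation D) {v u w : V} (h1 : (v, u, w) ∈ D) :
    (v, w, u) ∉ D := by
  obtain ⟨l, hl, h3, hD⟩ := h.link v
  rw [hD] at h1 ⊢
  exact hl.swap_not_mem_cyclicPairs h3 h1

theorem ne₂₃ (h : IsOrientedTriangulation D) {v u w : V} (h1 : (v, u, w) ∈ D) : u ≠ w := by
  rintro rfl
  exact h.swap_not_mem h1 h1

theorem ne₁₂ (h : IsOrientedTriangulation D) {v u w : V} (h1 : (v, u, w) ∈ D) : v ≠ u :=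
  h.ne₂₃ (h.shift (h.shift h1))

theorem ne₁₃ (h : IsOrientedTriangulation D) {v u w : V} (h1 : (v, u, w) ∈ D) : v ≠ w :=
  (h.ne₂₃ (h.shift h1)).symm

theorem exists_symm (h : IsOrientedTriangulation D) {v u w : V} (h1 : (v, u, w) ∈ D) :
    ∃ x, (u, v, x) ∈ D := by
  obtain ⟨l, -, -, hD⟩ := h.link u
  obtain ⟨x, hx⟩ := List.exists_mem_cyclicPairs_of_mem
    (List.right_mem_of_mem_cyclicPairs ((hD _ _).1 (h.shift h1)))
  exact ⟨x, (hD _ _).2 hx⟩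

section Extraction

variable [DecidableEq V]

/-- The unoriented faces. -/
def faces (D : Finset (V × V × V)) : Finset (Finset V) :=
  D.image fun t => {t.1, t.2.1, t.2.2}

/-- The edges. -/
def edges (D : Finset (V × V × V)) : Finset (Sym2 V) :=
  D.image fun t => s(t.1, t.2.1)

theorem mem_faces {f : Finset V} :
    f ∈ faces D ↔ ∃ v u w, (v, u, w) ∈ D ∧ f = {v, u, w} := by
  simp [faces, eq_comm]

theorem mem_edges {v u : V} (h : IsOrientedTriangulation D) :
    s(v, u) ∈ edges D ↔ ∃ w, (v, u, w) ∈ D := by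
  simp only [edges, Finset.mem_image, Prod.exists]
  constructor
  · rintro ⟨a, b, c, hD, he⟩
    rcases Sym2.eq_iff.1 he with ⟨rfl, rfl⟩ | ⟨rfl, rfl⟩
    · exact ⟨c, hD⟩
    · exact h.exists_symm hD
  · rintro ⟨w, hD⟩
    exact ⟨v, u, w, hD, rfl⟩

theorem exists_of_mem_face (h : IsOrientedTriangulation D) {f : Finset V} {v : V}
    (hf : f ∈ faces D) (hv : v ∈ f) : ∃ u w, (v, u, w) ∈ D ∧ f = {v, u, w} := by
  obtain ⟨a, b, c, hD, rfl⟩ := mem_faces.1 hf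
  simp only [Finset.mem_insert, Finset.mem_singleton] at hv
  rcases hv with rfl | rfl | rfl
  · exact ⟨_, _, hD, rfl⟩
  · exact ⟨_, _, h.shift hD, by grind⟩
  · exact ⟨_, _, h.shift (h.shift hD), by grind⟩

theorem exists_of_mem_face₂ (h : IsOrientedTriangulation D) {f : Finset V} {v u : V}
    (hf : f ∈ faces D) (hv : v ∈ f) (hu : u ∈ f) (hvu : v ≠ u) :
    ∃ w, f = {v, u, w} ∧ ((v, u, w) ∈ D ∨ (u, v, w) ∈ D) := by
  obtain ⟨b, c, hD, rfl⟩ := h.exists_of_mem_face hf hv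
  simp only [Finset.mem_insert, Finset.mem_singleton] at hu
  rcases hu with rfl | rfl | rfl
  · exact absurd rfl hvu
  · exact ⟨_, rfl, Or.inl hD⟩
  · exact ⟨b, by grind, Or.inr (h.shift (h.shift hD))⟩

/-- An unoriented face at `v` determines its oriented face. -/
theorem face_injective (h : IsOrientedTriangulation D) {v u w u' w' : V} (h1 : (v, u, w) ∈ D)
    (h2 : (v, u', w') ∈ D) (he : ({v, u, w} : Finset V) = {v, u', w'}) : u = u' ∧ w = w' := by
  have hu : u ∈ ({v, u', w'} : Finset V) := he ▸ by simp
  simp only [Finset.mem_insert, Finset.mem_singleton] at hu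
  rcases hu with rfl | rfl | rfl
  · exact absurd rfl (h.ne₁₂ h1)
  · exact ⟨rfl, h.unique h1 h2⟩
  · have hw : w ∈ ({v, u', u} : Finset V) := he ▸ by simp
    simp only [Finset.mem_insert, Finset.mem_singleton] at hw
    rcases hw with rfl | rfl | rfl
    · exact absurd rfl (h.ne₁₃ h1)
    · exact absurd h2 (h.swap_not_mem h1)
    · exact absurd rfl (h.ne₂₃ h1)

theorem card_filter_face (h : IsOrientedTriangulation D) {f : Finset V} (hf : f ∈ faces D) :
    (D.filter fun t => ({t.1, t.2.1, t.2.2} : Finset V) = f).card = 3 := by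
  obtain ⟨a, b, c, hD, rfl⟩ := mem_faces.1 hf
  have h2 := h.shift hD
  have h3 := h.shift h2
  have e : (D.filter fun t => ({t.1, t.2.1, t.2.2} : Finset V) = {a, b, c}) =
      {(a, b, c), (b, c, a), (c, a, b)} := by
    ext ⟨x, y, z⟩
    simp only [Finset.mem_filter, Finset.mem_insert, Finset.mem_singleton]
    constructor
    · rintro ⟨hx, he⟩
      have hxm : x ∈ ({a, b, c} : Finset V) := he ▸ by simp
      simp only [Finset.mem_insert, Finset.mem_singleton] at hxm
      rcases hxm with rfl | rfl | rfl
      · obtain ⟨rfl, rfl⟩ := h.face_injective hx hD he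
        simp
      · obtain ⟨rfl, rfl⟩ := h.face_injective hx h2 (he.trans (by grind))
        simp
      · obtain ⟨rfl, rfl⟩ := h.face_injective hx h3 (he.trans (by grind))
        simp
    · rintro (he | he | he) <;> obtain ⟨rfl, rfl, rfl⟩ := by simpa using he
      · exact ⟨hD, rfl⟩
      · exact ⟨h2, by grind⟩
      · exact ⟨h3, by grind⟩
  rw [e]
  have n1 := h.ne₁₂ hD
  have n2 := h.ne₁₃ hD
  have n3 := h.ne₂₃ hD
  rw [Finset.card_eq_three]
  exact ⟨_, _, _, by simp [n1], by simp [n2], by simp [n3], rfl⟩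

theorem filter_edge (h : IsOrientedTriangulation D) {v u w x : V} (h1 : (v, u, w) ∈ D)
    (h2 : (u, v, x) ∈ D) :
    (D.filter fun t => s(t.1, t.2.1) = s(v, u)) = {(v, u, w), (u, v, x)} := by
  ext ⟨a, b, c⟩
  simp only [Finset.mem_filter, Finset.mem_insert, Finset.mem_singleton, Sym2.eq_iff]
  constructor
  · rintro ⟨hD, ⟨rfl, rfl⟩ | ⟨rfl, rfl⟩⟩
    · simp [h.unique hD h1]
    · simp [h.unique hD h2]
  · rintro (he | he) <;> obtain ⟨rfl, rfl, rfl⟩ := by simpa using he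
    · exact ⟨h1, by simp⟩
    · exact ⟨h2, by simp⟩

theorem three_mul_card_faces (h : IsOrientedTriangulation D) :
    3 * (faces D).card = D.card := by
  rw [Finset.card_eq_sum_card_image (fun t : V × V × V => ({t.1, t.2.1, t.2.2} : Finset V)) D,
    show Finset.image (fun t : V × V × V => ({t.1, t.2.1, t.2.2} : Finset V)) D = faces D from rfl,
    Finset.sum_congr rfl fun f hf => h.card_filter_face hf]
  simp [mul_comm]

/-- Summing a symmetric function over the oriented edges counts each edge twice. -/
theorem sum_eq_two_mul_sum_edges (h : IsOrientedTriangulation D) (φ : Sym2 V → ℤ) :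
    ∑ t ∈ D, φ s(t.1, t.2.1) = 2 * ∑ e ∈ edges D, φ e := by
  rw [edges, Finset.mul_sum, ← Finset.sum_fiberwise_of_maps_to
    (g := fun t : V × V × V => s(t.1, t.2.1)) (fun t ht => Finset.mem_image.2 ⟨t, ht, rfl⟩)]
  refine Finset.sum_congr rfl fun e he => ?_
  induction e with | _ v u
  obtain ⟨w, h1⟩ := h.mem_edges.1 he
  obtain ⟨x, h2⟩ := h.exists_symm h1
  rw [Finset.sum_congr rfl (fun t ht => by rw [(Finset.mem_filter.1 ht).2]), Finset.sum_const,
    h.filter_edge h1 h2, Finset.card_pair (by simp [h.ne₁₂ h1])]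
  simp

theorem two_mul_card_edges (h : IsOrientedTriangulation D) : 2 * (edges D).card = D.card := by
  have := h.sum_eq_two_mul_sum_edges fun _ => 1
  simp only [Finset.sum_const, nsmul_eq_mul, mul_one] at this
  exact_mod_cast this.symm

theorem filter_faces_edge (h : IsOrientedTriangulation D) {v u w x : V} (h1 : (v, u, w) ∈ D)
    (h2 : (u, v, x) ∈ D) :
    ((faces D).filter fun f => ∀ y ∈ s(v, u), y ∈ f) = {{v, u, w}, {u, v, x}} := by
  ext f
  simp only [Finset.mem_filter, Finset.mem_insert, Finset.mem_singleton, Sym2.mem_iff,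
    forall_eq_or_imp, forall_eq]
  constructor
  · rintro ⟨hf, hv, hu⟩
    obtain ⟨z, rfl, hz | hz⟩ := h.exists_of_mem_face₂ hf hv hu (h.ne₁₂ h1)
    · exact Or.inl (by rw [h.unique hz h1])
    · right
      rw [h.unique hz h2]
      grind
  · rintro (rfl | rfl)
    · exact ⟨mem_faces.2 ⟨_, _, _, h1, rfl⟩, by simp⟩
    · exact ⟨mem_faces.2 ⟨_, _, _, h2, rfl⟩, by simp⟩

theorem linkIsCycle (h : IsOrientedTriangulation D) (v : V) : LinkIsCycle (faces D) v := by
  obtain ⟨l, hl, h3, hD⟩ := h.link v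
  have hlen : (l.cyclicPairs.map fun p => ({v, p.1, p.2} : Finset V)).length = l.length := by
    rw [List.length_map, List.length_cyclicPairs]
  have hmem : ∀ (i : ℕ) (hi : i < l.length),
      (v, l[i], l[(i + 1) % l.length]'(Nat.mod_lt _ (by omega))) ∈ D :=
    fun i hi => (hD _ _).2 (List.mem_cyclicPairs_iff.2 ⟨i, hi, rfl, rfl⟩)
  have hshare : ∀ (i j : ℕ) (hi : i < l.length) (hj : j < l.length), (i + 1) % l.length = j →
      SharesEdgeAt v {v, l[i], l[(i + 1) % l.length]'(Nat.mod_lt _ (by omega))}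
        {v, l[j], l[(j + 1) % l.length]'(Nat.mod_lt _ (by omega))} := by
    rintro i _ hi hj rfl
    refine ⟨fun he => ?_, _, (h.ne₁₂ (hmem _ hj)).symm, by simp, by simp⟩
    exact h.ne₂₃ (hmem _ hi) (h.face_injective (hmem _ hi) (hmem _ hj) he).1
  have hne : (l.cyclicPairs.map fun p => ({v, p.1, p.2} : Finset V)) ≠ [] := by
    rw [← List.length_pos_iff, hlen]; omega
  refine ⟨l.cyclicPairs.map fun p => {v, p.1, p.2}, hne, ?_, ?_, ?_, ?_⟩
  · refine List.Nodup.map_on ?_ ?_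
    · rintro ⟨a, b⟩ hab ⟨c, d⟩ hcd he
      obtain ⟨rfl, rfl⟩ := h.face_injective ((hD _ _).2 hab) ((hD _ _).2 hcd) he
      rfl
    · rw [List.nodup_iff_injective_getElem]
      intro i j hij
      simp only [List.getElem_cyclicPairs, Prod.mk.injEq] at hij
      exact Fin.ext ((hl.getElem_inj_iff).1 hij.1)
  · intro f
    simp only [List.mem_map, Prod.exists]
    constructor
    · rintro ⟨a, b, hab, rfl⟩
      exact ⟨mem_faces.2 ⟨_, _, _, (hD _ _).2 hab, rfl⟩, by simp⟩
    · rintro ⟨hf, hv⟩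
      obtain ⟨u, w, hD', rfl⟩ := h.exists_of_mem_face hf hv
      exact ⟨u, w, (hD _ _).1 hD', rfl⟩
  · refine List.isChain_iff_getElem.2 fun i hi => ?_
    rw [hlen] at hi
    simp only [List.getElem_map, List.getElem_cyclicPairs]
    exact hshare _ _ _ _ (Nat.mod_eq_of_lt hi)
  · rw [List.getLast_eq_getElem, List.head_eq_getElem]
    simp only [List.getElem_map, List.getElem_cyclicPairs]
    refine hshare _ _ _ _ ?_
    rw [hlen, show l.length - 1 + 1 = l.length by omega, Nat.mod_self]

theorem orientable (h : IsOrientedTriangulation D) : Orientable (faces D) := by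
  have hex : ∀ (f : Finset V) (v : V), ∃ u, ∀ u' w', (v, u', w') ∈ D → f = {v, u', w'} →
      u = u' := by
    intro f v
    by_cases hf : ∃ u w, (v, u, w) ∈ D ∧ f = {v, u, w}
    · obtain ⟨u, w, hD, rfl⟩ := hf
      exact ⟨u, fun u' w' hD' he => (h.face_injective hD hD' he).1⟩
    · exact ⟨v, fun u' w' hD' he => absurd ⟨u', w', hD', he⟩ hf⟩
  choose o ho using hex
  refine ⟨o, fun f hf v hv => ?_, fun f hf g hg hfg u w huf hwf hug hwg how => ?_⟩
  · obtain ⟨u, w, hD, rfl⟩ := h.exists_of_mem_face hf hv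
    rw [ho _ v u w hD rfl, ho _ u w v (h.shift hD) (by grind)]
    exact ⟨by simp, (h.ne₁₂ hD).symm, (h.ne₁₃ hD).symm⟩
  · obtain ⟨w', x, hD, rfl⟩ := h.exists_of_mem_face hf huf
    obtain rfl : w' = w := (ho _ u w' x hD rfl).symm.trans how
    obtain ⟨y, z, hD', rfl⟩ := h.exists_of_mem_face hg hwg
    rw [ho _ w' y z hD' rfl]
    simp only [Finset.mem_insert, Finset.mem_singleton] at hug
    rcases hug with rfl | rfl | rfl
    · exact absurd rfl (h.ne₁₂ hD)
    · rfl
    · obtain rfl := h.unique (h.shift (h.shift hD')) hD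
      exact absurd (by grind) hfg

end Extraction

end IsOrientedTriangulation

/-- An oriented face is not monochromatic. -/
def Bichromatic {V : Type*} (τ : V → Bool) (t : V × V × V) : Prop :=
  ¬(τ t.1 = τ t.2.1 ∧ τ t.2.1 = τ t.2.2)

/-- The integer spin encoded by a Boolean. -/
def boolSpin (b : Bool) : ℤ := if b then 1 else -1

theorem isSpin_boolSpin {V : Type*} (τ : V → Bool) : IsSpin fun v => boolSpin (τ v) := by
  intro v
  cases h : τ v <;> simp [boolSpin]

theorem boolSpin_not (b : Bool) : boolSpin (!b) = -boolSpin b := by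
  cases b <;> simp [boolSpin]

theorem IsSpin.exists_bool {V : Type*} {τ : V → ℤ} (h : IsSpin τ) :
    ∃ β : V → Bool, τ = fun v => boolSpin (β v) := by
  refine ⟨fun v => decide (τ v = 1), funext fun v => ?_⟩
  rcases h v with h | h <;> simp [h, boolSpin]

/-- The contribution of an oriented face to the energy. -/
def faceEnergy {V : Type*} (τ : V → Bool) (t : V × V × V) : ℤ :=
  boolSpin (τ t.1) * boolSpin (τ t.2.1) + boolSpin (τ t.2.1) * boolSpin (τ t.2.2) +
    boolSpin (τ t.2.2) * boolSpin (τ t.1)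

theorem neg_one_le_faceEnergy {V : Type*} (τ : V → Bool) (t : V × V × V) :
    -1 ≤ faceEnergy τ t := by
  unfold faceEnergy
  generalize τ t.1 = a
  generalize τ t.2.1 = b
  generalize τ t.2.2 = c
  revert a b c
  decide

theorem faceEnergy_eq_neg_one_iff {V : Type*} (τ : V → Bool) (t : V × V × V) :
    faceEnergy τ t = -1 ↔ Bichromatic τ t := by
  unfold faceEnergy Bichromatic
  generalize τ t.1 = a
  generalize τ t.2.1 = b
  generalize τ t.2.2 = c
  revert a b c
  decide

namespace IsOrientedTriangulation

variable {V : Type*} {D : Finset (V × V × V)}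

theorem sum_shift (h : IsOrientedTriangulation D) (φ : V × V × V → ℤ) :
    ∑ t ∈ D, φ (t.2.1, t.2.2, t.1) = ∑ t ∈ D, φ t :=
  Finset.sum_bij' (fun t _ => (t.2.1, t.2.2, t.1)) (fun t _ => (t.2.2, t.1, t.2.1))
    (fun _ ht => h.shift ht) (fun _ ht => h.shift (h.shift ht)) (fun _ _ => rfl) (fun _ _ => rfl)
    (fun _ _ => rfl)

variable [DecidableEq V]

theorem six_mul_hamiltonian (h : IsOrientedTriangulation D) (τ : V → Bool) :
    6 * Hamiltonian (edges D) (fun v => boolSpin (τ v)) = ∑ t ∈ D, faceEnergy τ t := by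
  have h1 := h.sum_eq_two_mul_sum_edges
    (Sym2.lift ⟨fun u v => boolSpin (τ u) * boolSpin (τ v), fun u v => mul_comm _ _⟩)
  simp only [Sym2.lift_mk] at h1
  have h2 := h.sum_shift fun t => boolSpin (τ t.1) * boolSpin (τ t.2.1)
  have h3 := h.sum_shift fun t => boolSpin (τ t.2.1) * boolSpin (τ t.2.2)
  simp only at h2 h3
  unfold faceEnergy
  rw [Finset.sum_add_distrib, Finset.sum_add_distrib, h3, h2, h1, Hamiltonian]
  ring

theorem isGroundstate_iff (h : IsOrientedTriangulation D) {σ : V → Bool}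
    (hσ : ∀ t ∈ D, Bichromatic σ t) (τ : V → Bool) :
    (∀ ρ : V → ℤ, IsSpin ρ →
      Hamiltonian (edges D) (fun v => boolSpin (τ v)) ≤ Hamiltonian (edges D) ρ) ↔
      ∀ t ∈ D, Bichromatic τ t := by
  constructor
  · intro hmin
    have h1 := hmin _ (isSpin_boolSpin σ)
    have h2 : ∑ t ∈ D, faceEnergy τ t ≤ ∑ t ∈ D, -1 := by
      rw [← Finset.sum_congr rfl fun t ht => (faceEnergy_eq_neg_one_iff σ t).2 (hσ t ht),
        ← h.six_mul_hamiltonian, ← h.six_mul_hamiltonian]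
      linarith
    have h3 := (Finset.sum_eq_sum_iff_of_le fun t _ => neg_one_le_faceEnergy τ t).1
      (le_antisymm (Finset.sum_le_sum fun t _ => neg_one_le_faceEnergy τ t) h2)
    exact fun t ht => (faceEnergy_eq_neg_one_iff τ t).1 (h3 t ht).symm
  · intro hτ ρ hρ
    obtain ⟨ρ, rfl⟩ := hρ.exists_bool
    have h1 := h.six_mul_hamiltonian τ
    have h2 := h.six_mul_hamiltonian ρ
    have h3 : ∑ t ∈ D, faceEnergy τ t ≤ ∑ t ∈ D, faceEnergy ρ t :=
      Finset.sum_le_sum fun t ht => by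
        rw [(faceEnergy_eq_neg_one_iff τ t).2 (hτ t ht)]
        exact neg_one_le_faceEnergy ρ t
    linarith

/-- If the bichromatic coloring is unique up to exchanging the colors, then the graph is
connected, because otherwise the colors could be exchanged on a single component. -/
theorem connected_of_unique (h : IsOrientedTriangulation D) [Nonempty V] {σ : V → Bool}
    (hσ : ∀ t ∈ D, Bichromatic σ t)
    (huniq : ∀ τ : V → Bool, (∀ t ∈ D, Bichromatic τ t) → τ = σ ∨ τ = fun v => !σ v) :
    (SimpleGraph.fromEdgeSet (edges D : Set (Sym2 V))).Connected := by
  have hadj : ∀ v u w, (v, u, w) ∈ D →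
      (SimpleGraph.fromEdgeSet (edges D : Set (Sym2 V))).Adj v u := fun v u w hD =>
    (SimpleGraph.fromEdgeSet_adj _).2 ⟨h.mem_edges.2 ⟨w, hD⟩, h.ne₁₂ hD⟩
  generalize SimpleGraph.fromEdgeSet (edges D : Set (Sym2 V)) = G at hadj
  refine (SimpleGraph.connected_iff_exists_forall_reachable _).2
    ⟨Classical.arbitrary V, fun v => ?_⟩
  set v₀ := Classical.arbitrary V
  let τ : V → Bool := fun v => if G.Reachable v₀ v then σ v else !σ v
  have hτ : ∀ t ∈ D, Bichromatic τ t := by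
    rintro ⟨x, y, z⟩ hD
    have hxy := hadj _ _ _ hD
    have hyz := hadj _ _ _ (h.shift hD)
    have e1 : G.Reachable v₀ x ↔ G.Reachable v₀ y :=
      ⟨fun hr => hr.trans hxy.reachable, fun hr => hr.trans hxy.symm.reachable⟩
    have e2 : G.Reachable v₀ y ↔ G.Reachable v₀ z :=
      ⟨fun hr => hr.trans hyz.reachable, fun hr => hr.trans hyz.symm.reachable⟩
    have := hσ _ hD
    simp only [Bichromatic, τ] at this ⊢
    by_cases hz : G.Reachable v₀ z <;> simpa [e1, e2, hz] using this
  by_contra hv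
  rcases huniq τ hτ with e | e
  · have := congrFun e v
    simp [τ, hv] at this
  · have := congrFun e v₀
    simp [τ] at this

theorem isCombTriangulation [Fintype V] [Nonempty V] (h : IsOrientedTriangulation D)
    {σ : V → Bool} (hσ : ∀ t ∈ D, Bichromatic σ t)
    (huniq : ∀ τ : V → Bool, (∀ t ∈ D, Bichromatic τ t) → τ = σ ∨ τ = fun v => !σ v) :
    IsCombTriangulation (edges D) (faces D) := by
  refine ⟨fun e he => ?_, h.connected_of_unique hσ huniq, fun f hf => ⟨?_, ?_⟩, fun e he => ?_,
    h.linkIsCycle⟩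
  · induction e with | _ v u
    obtain ⟨w, hD⟩ := h.mem_edges.1 he
    simpa using h.ne₁₂ hD
  · obtain ⟨v, u, w, hD, rfl⟩ := mem_faces.1 hf
    exact Finset.card_eq_three.2 ⟨v, u, w, h.ne₁₂ hD, h.ne₁₃ hD, h.ne₂₃ hD, rfl⟩
  · intro u hu v hv huv
    obtain ⟨w, -, hD | hD⟩ := h.exists_of_mem_face₂ hf hu hv huv
    · exact h.mem_edges.2 ⟨w, hD⟩
    · exact h.mem_edges.2 (h.exists_symm hD)
  · induction e with | _ v u
    obtain ⟨w, h1⟩ := h.mem_edges.1 he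
    obtain ⟨x, h2⟩ := h.exists_symm h1
    have hne : ({v, u, w} : Finset V) ≠ {u, v, x} := by
      intro he
      have h3 := (h.face_injective (h.shift h1) h2 (by grind)).1
      exact h.ne₁₃ h1 h3.symm
    have := Finset.card_pair hne
    rw [← h.filter_faces_edge h1 h2] at this
    convert this

end IsOrientedTriangulation

/-- The three cyclic shifts of an oriented face. -/
def corners {V : Type*} [DecidableEq V] (a b c : V) : Finset (V × V × V) :=
  {(a, b, c), (b, c, a), (c, a, b)}

theorem corners_shift {V : Type*} [DecidableEq V] (a b c : V) : corners b c a = corners a b c := by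
  ext
  simp only [corners, Finset.mem_insert, Finset.mem_singleton]
  tauto

theorem shift_mem_corners_iff {V : Type*} [DecidableEq V] {a b c x y z : V} :
    (y, z, x) ∈ corners a b c ↔ (x, y, z) ∈ corners a b c := by
  simp only [corners, Finset.mem_insert, Finset.mem_singleton, Prod.mk.injEq]
  tauto

namespace IsOrientedTriangulation

theorem corners_subset {V : Type*} [DecidableEq V] {D : Finset (V × V × V)}
    (h : IsOrientedTriangulation D) {a b c : V} (hD : (a, b, c) ∈ D) : corners a b c ⊆ D := by
  intro t ht
  simp only [corners, Finset.mem_insert, Finset.mem_singleton] at ht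
  rcases ht with rfl | rfl | rfl
  exacts [hD, h.shift hD, h.shift (h.shift hD)]

theorem card_corners {V : Type*} [DecidableEq V] {D : Finset (V × V × V)}
    (h : IsOrientedTriangulation D) {a b c : V} (hD : (a, b, c) ∈ D) :
    (corners a b c).card = 3 :=
  Finset.card_eq_three.2 ⟨_, _, _, by simp [h.ne₁₂ hD], by simp [h.ne₁₃ hD],
    by simp [h.ne₂₃ hD], rfl⟩

end IsOrientedTriangulation

section Glue

variable {V₁ V₂ V : Type*}

/-- The maps `i` and `j` exhibit `V` as the union of `V₁` and `V₂` in which exactly the vertices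
of the triangle `a b c` and of the triangle `a' b' c'` are identified. -/
structure IsTriangleSum (i : V₁ → V) (j : V₂ → V) (a b c : V₁) (a' b' c' : V₂) : Prop where
  inj_left : Function.Injective i
  inj_right : Function.Injective j
  eq₁ : i a = j a'
  eq₂ : i b = j b'
  eq₃ : i c = j c'
  eq_imp : ∀ {x y}, i x = j y → (x = a ∧ y = a') ∨ (x = b ∧ y = b') ∨ (x = c ∧ y = c')
  exhaust : ∀ v, (∃ x, i x = v) ∨ ∃ y, j y = v

theorem IsTriangleSum.shift {i : V₁ → V} {j : V₂ → V} {a b c : V₁} {a' b' c' : V₂}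
    (s : IsTriangleSum i j a b c a' b' c') : IsTriangleSum i j b c a b' c' a' where
  inj_left := s.inj_left
  inj_right := s.inj_right
  eq₁ := s.eq₂
  eq₂ := s.eq₃
  eq₃ := s.eq₁
  eq_imp h := by have := s.eq_imp h; tauto
  exhaust := s.exhaust

variable [DecidableEq V₁] [DecidableEq V₂] [DecidableEq V]

/-- The connected sum of two oriented triangulations along the oriented faces `(a, b, c)` and
`(a', c', b')`. -/
def glue (i : V₁ → V) (j : V₂ → V) (a b c : V₁) (a' b' c' : V₂) (D₁ : Finset (V₁ × V₁ × V₁))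
    (D₂ : Finset (V₂ × V₂ × V₂)) : Finset (V × V × V) :=
  (D₁ \ corners a b c).image (Prod.map i (Prod.map i i)) ∪
    (D₂ \ corners a' c' b').image (Prod.map j (Prod.map j j))

variable {i : V₁ → V} {j : V₂ → V} {a b c : V₁} {a' b' c' : V₂}
  {D₁ : Finset (V₁ × V₁ × V₁)} {D₂ : Finset (V₂ × V₂ × V₂)}

theorem mem_glue {v u w : V} :
    (v, u, w) ∈ glue i j a b c a' b' c' D₁ D₂ ↔
      (∃ x y z, (x, y, z) ∈ D₁ ∧ (x, y, z) ∉ corners a b c ∧ i x = v ∧ i y = u ∧ i z = w) ∨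
      (∃ x y z, (x, y, z) ∈ D₂ ∧ (x, y, z) ∉ corners a' c' b' ∧ j x = v ∧ j y = u ∧ j z = w) := by
  simp [glue, and_assoc]

theorem glue_shift : glue i j b c a b' c' a' D₁ D₂ = glue i j a b c a' b' c' D₁ D₂ := by
  rw [glue, glue, corners_shift a b c, ← corners_shift b' a' c']

theorem exists_link_glue_left (h₁ : IsOrientedTriangulation D₁)
    (s : IsTriangleSum i j a b c a' b' c') {x : V₁} (ha : x ≠ a) (hb : x ≠ b) (hc : x ≠ c) :
    ∃ l : List V, l.Nodup ∧ 3 ≤ l.length ∧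
      ∀ u w : V, (i x, u, w) ∈ glue i j a b c a' b' c' D₁ D₂ ↔ (u, w) ∈ l.cyclicPairs := by
  obtain ⟨l, hl, h3, hD⟩ := h₁.link x
  refine ⟨l.map i, hl.map s.inj_left, by simpa using h3, fun u w => ?_⟩
  rw [mem_glue, List.cyclicPairs_map, List.mem_map]
  constructor
  · rintro (⟨x', y, z, hD', -, hx, rfl, rfl⟩ | ⟨x', y, z, -, -, hx, -, -⟩)
    · obtain rfl := s.inj_left hx
      exact ⟨(y, z), (hD _ _).1 hD', rfl⟩
    · rcases s.eq_imp hx.symm with ⟨e, -⟩ | ⟨e, -⟩ | ⟨e, -⟩ <;> contradiction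
  · rintro ⟨⟨y, z⟩, hp, he⟩
    obtain ⟨rfl, rfl⟩ := Prod.mk.inj he
    exact Or.inl ⟨x, y, z, (hD _ _).2 hp, by simp [corners, ha, hb, hc], rfl, rfl, rfl⟩

theorem exists_link_glue_right (h₂ : IsOrientedTriangulation D₂)
    (s : IsTriangleSum i j a b c a' b' c') {x : V₂} (ha : x ≠ a') (hb : x ≠ b') (hc : x ≠ c') :
    ∃ l : List V, l.Nodup ∧ 3 ≤ l.length ∧
      ∀ u w : V, (j x, u, w) ∈ glue i j a b c a' b' c' D₁ D₂ ↔ (u, w) ∈ l.cyclicPairs := by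
  obtain ⟨l, hl, h3, hD⟩ := h₂.link x
  refine ⟨l.map j, hl.map s.inj_right, by simpa using h3, fun u w => ?_⟩
  rw [mem_glue, List.cyclicPairs_map, List.mem_map]
  constructor
  · rintro (⟨x', y, z, -, -, hx, -, -⟩ | ⟨x', y, z, hD', -, hx, rfl, rfl⟩)
    · rcases s.eq_imp hx with ⟨-, e⟩ | ⟨-, e⟩ | ⟨-, e⟩ <;> contradiction
    · obtain rfl := s.inj_right hx
      exact ⟨(y, z), (hD _ _).1 hD', rfl⟩
  · rintro ⟨⟨y, z⟩, hp, he⟩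
    obtain ⟨rfl, rfl⟩ := Prod.mk.inj he
    exact Or.inr ⟨x, y, z, (hD _ _).2 hp, by simp [corners, ha, hb, hc], rfl, rfl, rfl⟩

/-- The link of a vertex, cut open at a face containing it. -/
theorem IsOrientedTriangulation.exists_link_cons (h₁ : IsOrientedTriangulation D₁)
    (hD : (a, b, c) ∈ D₁) :
    ∃ m : List V₁, (c :: (m ++ [b])).Nodup ∧ 1 ≤ m.length ∧ a ∉ m ∧
      ∀ p : V₁ × V₁, p ∈ (c :: m).zip (m ++ [b]) ↔ (a, p) ∈ D₁ ∧ (a, p) ∉ corners a b c := by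
  obtain ⟨l, hl, h3, hl'⟩ := h₁.link a
  obtain ⟨m, hm⟩ := hl.exists_isRotated_of_mem_cyclicPairs h3 ((hl' _ _).1 hD)
  have hn := hm.nodup_iff.1 hl
  have hlen := hm.perm.length_eq
  simp only [List.length_cons, List.length_append, List.length_nil] at hlen
  refine ⟨m, hn, by omega, fun ham => ?_, fun ⟨y, z⟩ => ?_⟩
  · obtain ⟨w, hw⟩ := List.exists_mem_cyclicPairs_of_mem (hm.perm.mem_iff.2
      (List.mem_cons_of_mem c (List.mem_append_left [b] ham)))
    exact h₁.ne₁₂ ((hl' _ _).2 hw) rfl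
  · rw [hn.mem_zip_iff, ← hm.mem_cyclicPairs_iff, ← hl']
    simp [corners, h₁.ne₁₂ hD, h₁.ne₁₃ hD]

theorem exists_link_glue_corner (h₁ : IsOrientedTriangulation D₁)
    (h₂ : IsOrientedTriangulation D₂) (s : IsTriangleSum i j a b c a' b' c')
    (hD₁ : (a, b, c) ∈ D₁) (hD₂ : (a', c', b') ∈ D₂) :
    ∃ l : List V, l.Nodup ∧ 3 ≤ l.length ∧
      ∀ u w : V, (i a, u, w) ∈ glue i j a b c a' b' c' D₁ D₂ ↔ (u, w) ∈ l.cyclicPairs := by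
  obtain ⟨m, hn, hlen, ham, hm⟩ := h₁.exists_link_cons hD₁
  obtain ⟨m', hn', hlen', -, hm'⟩ := h₂.exists_link_cons hD₂
  refine ⟨i b :: (m'.map j ++ i c :: m.map i), ?_, ?_, fun u w => ?_⟩
  · simp only [List.nodup_cons, List.nodup_append', List.mem_append, List.mem_cons,
      not_or, List.disjoint_cons_right, List.mem_map, List.not_mem_nil, not_false_eq_true,
      and_true, List.disjoint_nil_right] at hn hn' ⊢
    obtain ⟨⟨hcm, hcb⟩, hmn, -, hbm⟩ := hn
    obtain ⟨⟨hbm', hbc'⟩, hmn', -, hcm'⟩ := hn'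
    refine ⟨⟨?_, ?_, ?_⟩, hmn'.map s.inj_right, ⟨?_, hmn.map s.inj_left⟩, ?_, ?_⟩
    · rintro ⟨y, hy, e⟩
      exact hbm' (s.inj_right (e.trans s.eq₂) ▸ hy)
    · exact fun e => hcb (s.inj_left e).symm
    · rintro ⟨y, hy, e⟩
      exact hbm (s.inj_left e ▸ hy)
    · rintro ⟨y, hy, e⟩
      exact hcm (s.inj_left e ▸ hy)
    · rintro ⟨y, hy, e⟩
      exact hcm' (s.inj_right (e.trans s.eq₃) ▸ hy)
    · intro v hv hv'
      obtain ⟨y, hy, rfl⟩ := List.mem_map.1 hv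
      obtain ⟨x, hx, e⟩ := List.mem_map.1 hv'
      rcases s.eq_imp e with ⟨rfl, -⟩ | ⟨rfl, -⟩ | ⟨rfl, -⟩ <;> contradiction
  · simp only [List.length_cons, List.length_append, List.length_map]
    omega
  · have e₁ : (i c :: m.map i).zip (m.map i ++ [i b]) =
        ((c :: m).zip (m ++ [b])).map (Prod.map i i) := by
      rw [← List.zip_map]; simp
    have e₂ : (i b :: m'.map j).zip (m'.map j ++ [i c]) =
        ((b' :: m').zip (m' ++ [c'])).map (Prod.map j j) := by
      rw [← List.zip_map]; simp [s.eq₂, s.eq₃]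
    rw [List.cyclicPairs_join, e₁, e₂, List.mem_append, List.mem_map, List.mem_map, mem_glue]
    simp only [hm, hm', Prod.exists, Prod.map_apply, Prod.mk.injEq]
    rw [or_comm]
    refine or_congr ⟨?_, ?_⟩ ⟨?_, ?_⟩
    · rintro ⟨x, y, z, hD, hc, hx, rfl, rfl⟩
      obtain rfl := s.inj_right (hx.trans s.eq₁)
      exact ⟨y, z, ⟨hD, hc⟩, rfl, rfl⟩
    · rintro ⟨y, z, ⟨hD, hc⟩, rfl, rfl⟩
      exact ⟨a', y, z, hD, hc, s.eq₁.symm, rfl, rfl⟩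
    · rintro ⟨x, y, z, hD, hc, hx, rfl, rfl⟩
      obtain rfl := s.inj_left hx
      exact ⟨y, z, ⟨hD, hc⟩, rfl, rfl⟩
    · rintro ⟨y, z, ⟨hD, hc⟩, rfl, rfl⟩
      exact ⟨a, y, z, hD, hc, rfl, rfl, rfl⟩

theorem isOrientedTriangulation_glue (h₁ : IsOrientedTriangulation D₁)
    (h₂ : IsOrientedTriangulation D₂) (s : IsTriangleSum i j a b c a' b' c')
    (hD₁ : (a, b, c) ∈ D₁) (hD₂ : (a', c', b') ∈ D₂) :
    IsOrientedTriangulation (glue i j a b c a' b' c' D₁ D₂) where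
  shift {v u w} h := by
    rw [mem_glue] at h ⊢
    rcases h with ⟨x, y, z, hD, hc, hx, hy, hz⟩ | ⟨x, y, z, hD, hc, hx, hy, hz⟩
    · exact Or.inl ⟨y, z, x, h₁.shift hD, by rwa [shift_mem_corners_iff], hy, hz, hx⟩
    · exact Or.inr ⟨y, z, x, h₂.shift hD, by rwa [shift_mem_corners_iff], hy, hz, hx⟩
  link v := by
    have ha := exists_link_glue_corner h₁ h₂ s hD₁ hD₂
    have hb := exists_link_glue_corner h₁ h₂ s.shift (h₁.shift hD₁) (h₂.shift (h₂.shift hD₂))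
    have hc := exists_link_glue_corner h₁ h₂ s.shift.shift (h₁.shift (h₁.shift hD₁))
      (h₂.shift hD₂)
    rw [glue_shift] at hb hc
    rw [glue_shift] at hc
    rcases s.exhaust v with ⟨x, rfl⟩ | ⟨y, rfl⟩
    · by_cases hxa : x = a
      · exact hxa ▸ ha
      by_cases hxb : x = b
      · exact hxb ▸ hb
      by_cases hxc : x = c
      · exact hxc ▸ hc
      exact exists_link_glue_left h₁ s hxa hxb hxc
    · by_cases hya : y = a'
      · rwa [hya, ← s.eq₁]
      by_cases hyb : y = b'
      · rwa [hyb, ← s.eq₂]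
      by_cases hyc : y = c'
      · rwa [hyc, ← s.eq₃]
      exact exists_link_glue_right h₂ s hya hyb hyc

theorem not_map_eq_of_not_mem_corners (h₁ : IsOrientedTriangulation D₁)
    (s : IsTriangleSum i j a b c a' b' c') (hD₁ : (a, b, c) ∈ D₁) {x y z : V₁} {x' y' z' : V₂}
    (hx : (x, y, z) ∈ D₁) (hxc : (x, y, z) ∉ corners a b c) (e₁ : i x = j x') (e₂ : i y = j y') :
    i z ≠ j z' := by
  intro e₃
  have n₁ := h₁.ne₁₂ hx
  have n₂ := h₁.ne₂₃ hx
  have n₃ := h₁.ne₁₃ hx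
  have k₁ := h₁.swap_not_mem hD₁
  have k₂ := h₁.swap_not_mem (h₁.shift hD₁)
  have k₃ := h₁.swap_not_mem (h₁.shift (h₁.shift hD₁))
  simp only [corners, Finset.mem_insert, Finset.mem_singleton, Prod.mk.injEq] at hxc
  rcases s.eq_imp e₁ with ⟨rfl, -⟩ | ⟨rfl, -⟩ | ⟨rfl, -⟩ <;>
  rcases s.eq_imp e₂ with ⟨rfl, -⟩ | ⟨rfl, -⟩ | ⟨rfl, -⟩ <;>
  rcases s.eq_imp e₃ with ⟨rfl, -⟩ | ⟨rfl, -⟩ | ⟨rfl, -⟩ <;> simp_all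

theorem card_glue (h₁ : IsOrientedTriangulation D₁) (h₂ : IsOrientedTriangulation D₂)
    (s : IsTriangleSum i j a b c a' b' c') (hD₁ : (a, b, c) ∈ D₁) (hD₂ : (a', c', b') ∈ D₂) :
    (glue i j a b c a' b' c' D₁ D₂).card + 6 = D₁.card + D₂.card := by
  rw [glue, Finset.card_union_of_disjoint, Finset.card_image_of_injective _
    (s.inj_left.prodMap (s.inj_left.prodMap s.inj_left)), Finset.card_image_of_injective _
    (s.inj_right.prodMap (s.inj_right.prodMap s.inj_right))]
  · have e₁ := Finset.card_sdiff_add_card_eq_card (h₁.corners_subset hD₁)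
    have e₂ := Finset.card_sdiff_add_card_eq_card (h₂.corners_subset hD₂)
    rw [h₁.card_corners hD₁] at e₁
    rw [h₂.card_corners hD₂] at e₂
    omega
  · rw [Finset.disjoint_left]
    rintro t ht ht'
    obtain ⟨⟨x, y, z⟩, hx, rfl⟩ := Finset.mem_image.1 ht
    obtain ⟨⟨x', y', z'⟩, hx', e⟩ := Finset.mem_image.1 ht'
    obtain ⟨hx, hxc⟩ := Finset.mem_sdiff.1 hx
    obtain ⟨hx', -⟩ := Finset.mem_sdiff.1 hx'
    simp only [Prod.map_apply, Prod.mk.injEq] at e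
    exact not_map_eq_of_not_mem_corners h₁ s hD₁ hx hxc e.1.symm e.2.1.symm
      e.2.2.symm

end Glue

/-- There is an oriented triangulation of a surface of genus `g` with vertex set `V` that has a
bichromatic coloring, and this coloring is unique up to exchanging the colors even if one of the
faces is allowed to be monochromatic. -/
def HasRigidTriangulation (g : ℕ) (V : Type*) [Fintype V] [DecidableEq V] : Prop :=
  ∃ (D : Finset (V × V × V)) (σ : V → Bool) (a b c : V),
    IsOrientedTriangulation D ∧ D.card + 12 = 6 * Fintype.card V + 12 * g ∧
    (a, b, c) ∈ D ∧ σ a = σ c ∧ σ b ≠ σ a ∧ (∀ t ∈ D, Bichromatic σ t) ∧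
    ∀ τ : V → Bool, (∀ t ∈ D, t ∉ corners a b c → Bichromatic τ t) →
      τ = σ ∨ τ = fun v => !σ v

theorem bichromatic_not_iff {V : Type*} {τ : V → Bool} {t : V × V × V} :
    Bichromatic (fun v => !τ v) t ↔ Bichromatic τ t := by
  simp [Bichromatic]

/-- The color at the first corner of the distinguished face may be prescribed. -/
theorem HasRigidTriangulation.exists_normalized {g : ℕ} {V : Type*} [Fintype V] [DecidableEq V]
    (h : HasRigidTriangulation g V) :
    ∃ (D : Finset (V × V × V)) (σ : V → Bool) (a b c : V),
      IsOrientedTriangulation D ∧ D.card + 12 = 6 * Fintype.card V + 12 * g ∧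
      (a, b, c) ∈ D ∧ σ a = true ∧ σ b = false ∧ σ c = true ∧ (∀ t ∈ D, Bichromatic σ t) ∧
      ∀ τ : V → Bool, (∀ t ∈ D, t ∉ corners a b c → Bichromatic τ t) →
        τ = σ ∨ τ = fun v => !σ v := by
  obtain ⟨D, σ, a, b, c, hD, hcard, habc, hac, hba, hσ, huniq⟩ := h
  cases ha : σ a with
  | true => exact ⟨D, σ, a, b, c, hD, hcard, habc, ha, by grind, by grind, hσ, huniq⟩
  | false =>
    refine ⟨D, fun v => !σ v, a, b, c, hD, hcard, habc, by grind, by grind, by grind,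
      fun t ht => bichromatic_not_iff.2 (hσ t ht), fun τ hτ => ?_⟩
    simpa [or_comm] using huniq τ hτ

theorem isTriangleSum_sum {V W : Type*} {a b c : V} (hab : a ≠ b) (hac : a ≠ c) (hbc : b ≠ c) :
    IsTriangleSum (Sum.inl : V → V ⊕ W) (Sum.map ![a, b, c] id : Fin 3 ⊕ W → V ⊕ W) a b c
      (Sum.inl 0) (Sum.inl 1) (Sum.inl 2) where
  inj_left := Sum.inl_injective
  inj_right := by
    refine Sum.map_injective.2 ⟨?_, Function.injective_id⟩
    intro x y
    fin_cases x <;> fin_cases y <;> simp [hab, hac, hbc, hab.symm, hac.symm, hbc.symm]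
  eq₁ := rfl
  eq₂ := rfl
  eq₃ := rfl
  eq_imp {x y} h := by
    rcases y with y | y
    · fin_cases y <;> simp_all
    · simp at h
  exhaust v := by
    rcases v with x | y
    · exact Or.inl ⟨x, rfl⟩
    · exact Or.inr ⟨Sum.inr y, rfl⟩

/-- Attaching a triangulation with three marked vertices along the distinguished face. -/
theorem HasRigidTriangulation.attach {g k : ℕ} {V W : Type*} [Fintype V] [DecidableEq V]
    [Fintype W] [DecidableEq W] (h : HasRigidTriangulation g V)
    {D₂ : Finset ((Fin 3 ⊕ W) × (Fin 3 ⊕ W) × (Fin 3 ⊕ W))} (h₂ : IsOrientedTriangulation D₂)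
    (hcard₂ : D₂.card + 12 = 6 * (3 + Fintype.card W) + 12 * k)
    (hface : (Sum.inl 0, Sum.inl 2, Sum.inl 1) ∈ D₂) {σ₂ : Fin 3 ⊕ W → Bool}
    (h0 : σ₂ (Sum.inl 0) = true) (h1 : σ₂ (Sum.inl 1) = false) (h2 : σ₂ (Sum.inl 2) = true)
    {x y z : Fin 3 ⊕ W} (hxyz : (x, y, z) ∈ D₂)
    (hne : (x, y, z) ∉ corners (Sum.inl 0) (Sum.inl 2) (Sum.inl 1))
    (hxz : σ₂ x = σ₂ z) (hyx : σ₂ y ≠ σ₂ x) (hσ₂ : ∀ t ∈ D₂, Bichromatic σ₂ t)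
    (huniq₂ : ∀ τ : Fin 3 ⊕ W → Bool, τ (Sum.inl 0) = true → τ (Sum.inl 1) = false →
      τ (Sum.inl 2) = true → (∀ t ∈ D₂, t ∉ corners (Sum.inl 0) (Sum.inl 2) (Sum.inl 1) →
        t ∉ corners x y z → Bichromatic τ t) → τ = σ₂) :
    HasRigidTriangulation (g + k) (V ⊕ W) := by
  obtain ⟨D₁, σ₁, a, b, c, h₁, hcard₁, habc, ha, hb, hc, hσ₁, huniq₁⟩ := h.exists_normalized
  have s := isTriangleSum_sum (W := W) (h₁.ne₁₂ habc) (h₁.ne₁₃ habc) (h₁.ne₂₃ habc)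
  have hcard := card_glue h₁ h₂ s habc hface
  have hglue := isOrientedTriangulation_glue h₁ h₂ s habc hface
  set j : Fin 3 ⊕ W → V ⊕ W := Sum.map ![a, b, c] id with hj
  set D := glue Sum.inl j a b c (Sum.inl 0) (Sum.inl 1) (Sum.inl 2) D₁ D₂
  let σ : V ⊕ W → Bool := Sum.elim σ₁ fun w => σ₂ (Sum.inr w)
  have hσj : ∀ q, σ (j q) = σ₂ q := by
    rintro (q | q)
    · fin_cases q <;> simp [σ, hj, ha, hb, hc, h0, h1, h2]
    · rfl
  have hmem₂ : ∀ p q r, (p, q, r) ∈ D₂ →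
      (p, q, r) ∉ corners (Sum.inl 0 : Fin 3 ⊕ W) (Sum.inl 2) (Sum.inl 1) →
      (j p, j q, j r) ∈ D :=
    fun p q r hD hn => mem_glue.2 (Or.inr ⟨p, q, r, hD, hn, rfl, rfl, rfl⟩)
  have hmem₁ : ∀ p q r, (p, q, r) ∈ D₁ → (p, q, r) ∉ corners a b c →
      (Sum.inl p, Sum.inl q, Sum.inl r) ∈ D :=
    fun p q r hD hn => mem_glue.2 (Or.inl ⟨p, q, r, hD, hn, rfl, rfl, rfl⟩)
  have hcorner : ∀ p q r, (j p, j q, j r) ∈ corners (j x) (j y) (j z) →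
      (p, q, r) ∈ corners x y z := by
    intro p q r
    simp only [corners, Finset.mem_insert, Finset.mem_singleton, Prod.mk.injEq,
      s.inj_right.eq_iff, imp_self]
  have hcorner₁ : ∀ p q r, (p, q, r) ∈ D₁ → (p, q, r) ∉ corners a b c →
      (Sum.inl p, Sum.inl q, Sum.inl r) ∉ corners (j x) (j y) (j z) := by
    intro p q r hD hn hm
    have hno := fun {x' y' z'} => not_map_eq_of_not_mem_corners h₁ s habc
      (x' := x') (y' := y') (z' := z') hD hn
    simp only [corners, Finset.mem_insert, Finset.mem_singleton, Prod.mk.injEq] at hm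
    rcases hm with ⟨e₁, e₂, e₃⟩ | ⟨e₁, e₂, e₃⟩ | ⟨e₁, e₂, e₃⟩ <;> exact hno e₁ e₂ e₃
  have key : ∀ τ : V ⊕ W → Bool, (∀ t ∈ D, t ∉ corners (j x) (j y) (j z) → Bichromatic τ t) →
      (fun v => τ (Sum.inl v)) = σ₁ → τ = σ := by
    intro τ hτ h
    have h' : ∀ v, τ (Sum.inl v) = σ₁ v := congrFun h
    have := huniq₂ (fun q => τ (j q)) (by simp [hj, h', ha]) (by simp [hj, h', hb])
      (by simp [hj, h', hc]) fun ⟨p, q, r⟩ hD hn hn' =>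
        hτ _ (hmem₂ p q r hD hn) fun hm => hn' (hcorner _ _ _ hm)
    funext v
    rcases v with v | w
    · exact h' v
    · exact congrFun this (Sum.inr w)
  refine ⟨D, σ, j x, j y, j z, hglue, ?_, hmem₂ _ _ _ hxyz hne, by rwa [hσj, hσj],
    by rwa [hσj, hσj], ?_, fun τ hτ => ?_⟩
  · rw [Fintype.card_sum]
    omega
  · rintro ⟨v, u, w⟩ ht
    rcases mem_glue.1 ht with ⟨p, q, r, hD, -, rfl, rfl, rfl⟩ | ⟨p, q, r, hD, -, rfl, rfl, rfl⟩
    · exact hσ₁ _ hD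
    · have := hσ₂ _ hD
      simpa only [Bichromatic, hσj] using this
  · rcases huniq₁ (fun v => τ (Sum.inl v)) fun ⟨p, q, r⟩ hD hn =>
      hτ _ (hmem₁ p q r hD hn) (hcorner₁ _ _ _ hD hn) with h | h
    · exact Or.inl (key τ hτ h)
    · right
      have := key (fun v => !τ v) (fun t ht htc => bichromatic_not_iff.2 (hτ t ht htc))
        (by funext v; simp [congrFun h v])
      funext v
      simp [← congrFun this v]

theorem HasRigidTriangulation.congr {g : ℕ} {V V' : Type*} [Fintype V] [DecidableEq V]
    [Fintype V'] [DecidableEq V'] (e : V ≃ V') (h : HasRigidTriangulation g V) :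
    HasRigidTriangulation g V' := by
  obtain ⟨D, σ, a, b, c, hD, hcard, habc, hac, hba, hσ, huniq⟩ := h
  have hmem : ∀ x y z, (e x, e y, e z) ∈ D.map (e.prodCongr (e.prodCongr e)).toEmbedding ↔
      (x, y, z) ∈ D := by
    intro x y z
    simp
  have hcor : ∀ x y z, (e x, e y, e z) ∈ corners (e a) (e b) (e c) ↔
      (x, y, z) ∈ corners a b c := by
    intro x y z
    simp [corners]
  refine ⟨D.map (e.prodCongr (e.prodCongr e)).toEmbedding, fun v => σ (e.symm v), e a, e b, e c,
    ⟨?_, ?_⟩, ?_, (hmem _ _ _).2 habc, by simpa, by simpa, ?_, ?_⟩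
  · intro v u w
    obtain ⟨v, rfl⟩ := e.surjective v
    obtain ⟨u, rfl⟩ := e.surjective u
    obtain ⟨w, rfl⟩ := e.surjective w
    rw [hmem, hmem]
    exact hD.shift
  · intro v
    obtain ⟨v, rfl⟩ := e.surjective v
    obtain ⟨l, hl, h3, hlD⟩ := hD.link v
    refine ⟨l.map e, hl.map e.injective, by simpa using h3, fun u w => ?_⟩
    obtain ⟨u, rfl⟩ := e.surjective u
    obtain ⟨w, rfl⟩ := e.surjective w
    rw [hmem, hlD, List.cyclicPairs_map]
    exact (List.mem_map_of_injective (e.injective.prodMap e.injective)).symm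
  · rw [Finset.card_map, hcard, Fintype.card_congr e]
  · rintro ⟨v, u, w⟩ h
    obtain ⟨v, rfl⟩ := e.surjective v
    obtain ⟨u, rfl⟩ := e.surjective u
    obtain ⟨w, rfl⟩ := e.surjective w
    have := hσ _ ((hmem _ _ _).1 h)
    simpa [Bichromatic] using this
  · intro τ hτ
    have := huniq (fun v => τ (e v)) fun ⟨x, y, z⟩ hD hn =>
      hτ _ ((hmem _ _ _).2 hD) (mt (hcor _ _ _).1 hn)
    refine this.imp (fun h => ?_) fun h => ?_ <;>
    · funext v
      simpa using congrFun h (e.symm v)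

/-- The oriented triples of a list of oriented faces. -/
def orientedTriples {V : Type*} [DecidableEq V] (l : List (V × V × V)) : Finset (V × V × V) :=
  (l.flatMap fun t => [t, (t.2.1, t.2.2, t.1), (t.2.2, t.1, t.2.1)]).toFinset

/-- The tetrahedron. -/
def tetrahedron : Finset ((Fin 3 ⊕ Fin 1) × (Fin 3 ⊕ Fin 1) × (Fin 3 ⊕ Fin 1)) :=
  orientedTriples [(.inl 0, .inl 2, .inl 1), (.inl 0, .inl 1, .inr 0), (.inl 1, .inl 2, .inr 0),
    (.inl 2, .inl 0, .inr 0)]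

/-- A triangulation of the torus with eight vertices. -/
def eightVertexTorus : Finset ((Fin 3 ⊕ Fin 5) × (Fin 3 ⊕ Fin 5) × (Fin 3 ⊕ Fin 5)) :=
  orientedTriples [
    (.inl 2, .inr 0, .inl 1), (.inl 2, .inl 0, .inr 3), (.inl 2, .inl 1, .inl 0),
    (.inl 2, .inr 1, .inr 2), (.inl 2, .inr 2, .inr 0), (.inl 2, .inr 3, .inr 1),
    (.inr 0, .inl 0, .inr 1), (.inr 0, .inr 1, .inr 4), (.inr 0, .inr 2, .inr 3),
    (.inr 0, .inr 3, .inl 0), (.inr 0, .inr 4, .inl 1), (.inl 0, .inl 1, .inr 2),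
    (.inl 0, .inr 2, .inr 1), (.inl 1, .inr 3, .inr 2), (.inl 1, .inr 4, .inr 3),
    (.inr 1, .inr 3, .inr 4)]

/-- The neighbors of a vertex of `tetrahedron` in cyclic order. -/
def tetrahedronLink : Fin 3 ⊕ Fin 1 → List (Fin 3 ⊕ Fin 1) :=
  Sum.elim ![[.inl 1, .inr 0, .inl 2], [.inl 0, .inl 2, .inr 0], [.inl 0, .inr 0, .inl 1]]
    ![[.inl 0, .inl 1, .inl 2]]

/-- The neighbors of a vertex of `eightVertexTorus` in cyclic order. -/
def eightVertexTorusLink : Fin 3 ⊕ Fin 5 → List (Fin 3 ⊕ Fin 5) :=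
  Sum.elim ![
    [.inl 2, .inl 1, .inr 2, .inr 1, .inr 0, .inr 3],
    [.inl 2, .inr 0, .inr 4, .inr 3, .inr 2, .inl 0],
    [.inr 0, .inl 1, .inl 0, .inr 3, .inr 1, .inr 2]] ![
    [.inl 2, .inr 2, .inr 3, .inl 0, .inr 1, .inr 4, .inl 1],
    [.inl 2, .inr 3, .inr 4, .inr 0, .inl 0, .inr 2],
    [.inl 2, .inr 1, .inl 0, .inl 1, .inr 3, .inr 0],
    [.inl 2, .inl 0, .inr 0, .inr 2, .inl 1, .inr 4, .inr 1],
    [.inr 0, .inr 1, .inr 3, .inl 1]]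

theorem isOrientedTriangulation_tetrahedron : IsOrientedTriangulation tetrahedron where
  shift {v u w} := by revert v u w; decide +kernel
  link v := ⟨tetrahedronLink v, by revert v; decide +kernel, by revert v; decide +kernel,
    fun u w => by
      rw [List.cyclicPairs, ← List.mem_toFinset]
      revert v u w
      decide +kernel⟩

theorem isOrientedTriangulation_eightVertexTorus : IsOrientedTriangulation eightVertexTorus where
  shift {v u w} := by revert v u w; decide +kernel
  link v := ⟨eightVertexTorusLink v, by revert v; decide +kernel, by revert v; decide +kernel,
    fun u w => by
      rw [List.cyclicPairs, ← List.mem_toFinset]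
      revert v u w
      decide +kernel⟩

/-- The bichromatic coloring of `eightVertexTorus`. -/
def eightVertexTorusColoring : Fin 3 ⊕ Fin 5 → Bool :=
  Sum.elim ![true, false, true] ![false, false, true, false, true]

theorem bichromatic_eightVertexTorusColoring :
    ∀ t ∈ eightVertexTorus, Bichromatic eightVertexTorusColoring t := by
  unfold Bichromatic
  decide +kernel

theorem eightVertexTorus_unique (τ : Fin 3 ⊕ Fin 5 → Bool)
    (h : ∀ t ∈ eightVertexTorus, t ∉ corners (.inl 0) (.inl 2) (.inl 1) →
      t ∉ corners (.inr 3) (.inr 4) (.inr 1) → Bichromatic τ t) :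
    τ = eightVertexTorusColoring ∨ τ = fun v => !eightVertexTorusColoring v := by
  have h0 := h (.inl 2, .inr 0, .inl 1) (by decide +kernel) (by decide +kernel) (by decide +kernel)
  have h1 := h (.inl 2, .inl 0, .inr 3) (by decide +kernel) (by decide +kernel) (by decide +kernel)
  have h3 := h (.inl 2, .inr 1, .inr 2) (by decide +kernel) (by decide +kernel) (by decide +kernel)
  have h4 := h (.inl 2, .inr 2, .inr 0) (by decide +kernel) (by decide +kernel) (by decide +kernel)
  have h5 := h (.inl 2, .inr 3, .inr 1) (by decide +kernel) (by decide +kernel) (by decide +kernel)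
  have h6 := h (.inr 0, .inl 0, .inr 1) (by decide +kernel) (by decide +kernel) (by decide +kernel)
  have h7 := h (.inr 0, .inr 1, .inr 4) (by decide +kernel) (by decide +kernel) (by decide +kernel)
  have h8 := h (.inr 0, .inr 2, .inr 3) (by decide +kernel) (by decide +kernel) (by decide +kernel)
  have h9 := h (.inr 0, .inr 3, .inl 0) (by decide +kernel) (by decide +kernel) (by decide +kernel)
  have h10 := h (.inr 0, .inr 4, .inl 1) (by decide +kernel) (by decide +kernel) (by decide +kernel)
  have h11 := h (.inl 0, .inl 1, .inr 2) (by decide +kernel) (by decide +kernel) (by decide +kernel)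
  have h12 := h (.inl 0, .inr 2, .inr 1) (by decide +kernel) (by decide +kernel) (by decide +kernel)
  have h13 := h (.inl 1, .inr 3, .inr 2) (by decide +kernel) (by decide +kernel) (by decide +kernel)
  have h14 := h (.inl 1, .inr 4, .inr 3) (by decide +kernel) (by decide +kernel) (by decide +kernel)
  have hext : ∀ σ : Fin 3 ⊕ Fin 5 → Bool, τ = σ ↔
      τ (.inl 0) = σ (.inl 0) ∧ τ (.inl 1) = σ (.inl 1) ∧ τ (.inl 2) = σ (.inl 2) ∧
      τ (.inr 0) = σ (.inr 0) ∧ τ (.inr 1) = σ (.inr 1) ∧ τ (.inr 2) = σ (.inr 2) ∧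
      τ (.inr 3) = σ (.inr 3) ∧ τ (.inr 4) = σ (.inr 4) := by
    intro σ
    simp [funext_iff, Sum.forall, Fin.forall_fin_succ, and_assoc]
  rw [hext, hext]
  clear hext h
  simp only [Bichromatic] at h0 h1 h3 h4 h5 h6 h7 h8 h9 h10 h11 h12 h13 h14
  generalize τ (.inl 0) = a at *
  generalize τ (.inl 1) = b at *
  generalize τ (.inl 2) = c at *
  generalize τ (.inr 0) = d at *
  generalize τ (.inr 1) = e at *
  generalize τ (.inr 2) = f at *
  generalize τ (.inr 3) = g at *
  generalize τ (.inr 4) = h at *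
  simp only [eightVertexTorusColoring, Sum.elim_inl, Sum.elim_inr, Matrix.cons_val]
  cases a <;> cases b <;> cases c <;> grind

theorem hasRigidTriangulation_torus : HasRigidTriangulation 1 (Fin 3 ⊕ Fin 5) :=
  ⟨eightVertexTorus, eightVertexTorusColoring, .inr 3, .inr 4, .inr 1,
    isOrientedTriangulation_eightVertexTorus, by decide +kernel, by decide +kernel, rfl,
    by decide, bichromatic_eightVertexTorusColoring,
    fun τ hτ => eightVertexTorus_unique τ fun t ht _ hn => hτ t ht hn⟩

theorem HasRigidTriangulation.attach_torus {g : ℕ} {V : Type*} [Fintype V] [DecidableEq V]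
    (h : HasRigidTriangulation g V) : HasRigidTriangulation (g + 1) (V ⊕ Fin 5) := by
  refine h.attach isOrientedTriangulation_eightVertexTorus (by decide +kernel)
    (by decide +kernel) (σ₂ := eightVertexTorusColoring) rfl rfl rfl
    (x := .inr 3) (y := .inr 4) (z := .inr 1)
    (by decide +kernel) (by decide +kernel) rfl (by decide) bichromatic_eightVertexTorusColoring
    fun τ h0 _ _ hτ => ?_
  refine (eightVertexTorus_unique τ hτ).resolve_right fun e => ?_
  rw [e] at h0
  exact absurd h0 (by decide)

theorem HasRigidTriangulation.attach_tetrahedron {g : ℕ} {V : Type*} [Fintype V] [DecidableEq V]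
    (h : HasRigidTriangulation g V) : HasRigidTriangulation g (V ⊕ Fin 1) := by
  refine h.attach (k := 0) isOrientedTriangulation_tetrahedron (by decide +kernel)
    (by decide +kernel) (σ₂ := Sum.elim ![true, false, true] ![false]) rfl rfl rfl
    (x := .inl 1) (y := .inl 2) (z := .inr 0)
    (by decide +kernel) (by decide +kernel) rfl (by decide)
    (by unfold Bichromatic; decide +kernel) fun τ h0 h1 h2 hτ => ?_
  have h3 := hτ (.inl 2, .inl 0, .inr 0) (by decide +kernel) (by decide +kernel)
    (by decide +kernel)
  simp only [Bichromatic, h0, h2, true_and] at h3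
  rw [funext_iff]
  simpa [Sum.forall, Fin.forall_fin_succ, h0, h1, h2] using h3

theorem exists_hasRigidTriangulation (g n : ℕ) :
    ∃ m, n ≤ m ∧ HasRigidTriangulation (g + 1) (Fin m) := by
  induction n with
  | zero =>
    induction g with
    | zero => exact ⟨8, by simp, hasRigidTriangulation_torus.congr finSumFinEquiv⟩
    | succ g ih =>
      obtain ⟨m, -, hm⟩ := ih
      exact ⟨m + 5, by simp, hm.attach_torus.congr finSumFinEquiv⟩
  | succ n ih =>
    obtain ⟨m, hn, hm⟩ := ih
    exact ⟨m + 1, by omega, hm.attach_tetrahedron.congr finSumFinEquiv⟩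

/-- For every integer `g ≥ 1` and natural number `n` there is an orientable combinatorial
triangulation of a closed surface of Euler characteristic `2 - 2g` with at least `n` vertices
on which the antiferromagnetic Ising model has a non-degenerate groundstate: there is a spin
assignment `σ` such that the minimizers of the Hamiltonian are exactly `σ` and `-σ`. -/
theorem genus_g_triangulation_with_nondegenerate_groundstate (g : ℤ) (hg : 1 ≤ g) (n : ℕ) :
    ∃ (m : ℕ) (E : Finset (Sym2 (Fin m))) (F : Finset (Finset (Fin m))),
      n ≤ m ∧
      IsCombTriangulation E F ∧
      Orientable F ∧
      (m : ℤ) - (E.card : ℤ) + (F.card : ℤ) = 2 - 2 * g ∧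
      ∃ σ : Fin m → ℤ, IsSpin σ ∧
        ∀ τ : Fin m → ℤ,
          ((IsSpin τ ∧ ∀ ρ : Fin m → ℤ, IsSpin ρ → Hamiltonian E τ ≤ Hamiltonian E ρ)
            ↔ (τ = σ ∨ τ = -σ)) := by
  obtain ⟨k, rfl⟩ : ∃ k : ℕ, g = k + 1 := ⟨(g - 1).toNat, by omega⟩
  obtain ⟨m, hn, D, σ, a, b, c, hD, hcard, -, -, -, hσ, huniq⟩ := exists_hasRigidTriangulation k n
  have : Nonempty (Fin m) := ⟨a⟩
  replace huniq : ∀ τ : Fin m → Bool, (∀ t ∈ D, Bichromatic τ t) → τ = σ ∨ τ = fun v => !σ v :=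
    fun τ hτ => huniq τ fun t ht _ => hτ t ht
  refine ⟨m, IsOrientedTriangulation.edges D, IsOrientedTriangulation.faces D, hn,
    hD.isCombTriangulation hσ huniq, hD.orientable, ?_, fun v => boolSpin (σ v),
    isSpin_boolSpin σ, fun τ => ⟨?_, ?_⟩⟩
  · have h3 := hD.three_mul_card_faces
    have h2 := hD.two_mul_card_edges
    rw [Fintype.card_fin] at hcard
    omega
  · rintro ⟨hτ, hmin⟩
    obtain ⟨β, rfl⟩ := hτ.exists_bool
    rcases huniq β ((hD.isGroundstate_iff hσ β).1 hmin) with rfl | rfl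
    · exact Or.inl rfl
    · exact Or.inr (funext fun v => boolSpin_not _)
  · rintro (rfl | rfl)
    · exact ⟨isSpin_boolSpin σ, (hD.isGroundstate_iff hσ σ).2 hσ⟩
    · have e : -(fun v => boolSpin (σ v)) = fun v => boolSpin (!σ v) :=
        funext fun v => (boolSpin_not _).symm
      rw [e]
      exact ⟨isSpin_boolSpin _, (hD.isGroundstate_iff hσ _).2 fun t ht =>
        bichromatic_not_iff.2 (hσ t ht)⟩
end

section
/- For every n ≥ 1, there exist exactly two satisfying spin assignments σ on the stack triangulation Δ_n with σ(x) = σ(y_n), and these two assignments are negatives of each other. -/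
/-- A face is monochromatic under `σ` when `σ` is constant on it. -/
def FaceMono {V : Type*} (σ : V → ℤ) (f : Finset V) : Prop :=
  ∀ u ∈ f, ∀ v ∈ f, σ u = σ v

/-- A satisfying spin assignment: a spin assignment under which no face is monochromatic. -/
def Satisfying {V : Type*} (F : Finset (Finset V)) (σ : V → ℤ) : Prop :=
  IsSpin σ ∧ ∀ f ∈ F, ¬ FaceMono σ f

/-- Vertices of the stack triangulation `Δ_n`: `Sum.inl i` is `y_i` (for `0 ≤ i ≤ n`),
`Sum.inr false` is `x` and `Sum.inr true` is `z`. -/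
abbrev StackV (n : ℕ) := Fin (n + 1) ⊕ Bool

/-- The vertex `x` of `Δ_n`. -/
def vx {n : ℕ} : StackV n := Sum.inr false

/-- The vertex `z` of `Δ_n`. -/
def vz {n : ℕ} : StackV n := Sum.inr true

/-- The vertex `y_i` of `Δ_n`. -/
def vy {n : ℕ} (i : Fin (n + 1)) : StackV n := Sum.inl i

/-- The faces of the stack triangulation `Δ_n`: `{x, y₀, z}`, `{x, y_n, z}` and, for each
`1 ≤ i ≤ n`, the faces `{x, y_{i-1}, y_i}` and `{z, y_{i-1}, y_i}`. -/
def StackFaces (n : ℕ) : Finset (Finset (StackV n)) :=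
  ({{vx, vy 0, vz}, {vx, vy (Fin.last n), vz}} : Finset (Finset (StackV n))) ∪
    Finset.image (fun i : Fin n => {vx, vy i.castSucc, vy i.succ}) Finset.univ ∪
    Finset.image (fun i : Fin n => {vz, vy i.castSucc, vy i.succ}) Finset.univ

theorem faceMono_triple {V : Type*} [DecidableEq V] (σ : V → ℤ) (a b c : V) :
    FaceMono σ {a, b, c} ↔ σ a = σ b ∧ σ a = σ c := by
  constructor
  · intro h
    exact ⟨h a (by simp) b (by simp), h a (by simp) c (by simp)⟩
  · rintro ⟨hb, hc⟩
    simp [FaceMono, ← hb, ← hc]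

theorem satisfying_stackFaces_iff {n : ℕ} (σ : StackV n → ℤ) :
    Satisfying (StackFaces n) σ ↔ IsSpin σ ∧
      ¬ (σ vx = σ (vy 0) ∧ σ vx = σ vz) ∧ ¬ (σ vx = σ (vy (Fin.last n)) ∧ σ vx = σ vz) ∧
      (∀ i : Fin n, ¬ (σ vx = σ (vy i.castSucc) ∧ σ vx = σ (vy i.succ))) ∧
      ∀ i : Fin n, ¬ (σ vz = σ (vy i.castSucc) ∧ σ vz = σ (vy i.succ)) := by
  simp only [Satisfying, StackFaces, Finset.forall_mem_union, Finset.forall_mem_image,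
    Finset.forall_mem_insert, Finset.mem_singleton, forall_eq, Finset.mem_univ, true_imp_iff,
    faceMono_triple, and_assoc]

/-- With `σ(x) = σ(y_n)`, satisfying means that `z` is opposite to `x` and the spins of the `y_i`
alternate. -/
theorem satisfying_stackFaces_iff_alternating {n : ℕ} {σ : StackV n → ℤ} (hs : IsSpin σ)
    (hx : σ vx = σ (vy (Fin.last n))) :
    Satisfying (StackFaces n) σ ↔
      σ vz = -σ vx ∧ ∀ i : Fin n, σ (vy i.castSucc) = -σ (vy i.succ) := by
  rw [satisfying_stackFaces_iff]
  have hsx := hs vx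
  have hsz := hs vz
  constructor
  · rintro ⟨-, -, hl, hxy, hzy⟩
    have hz : σ vz = -σ vx := by grind
    refine ⟨hz, fun i => ?_⟩
    have := hs (vy i.castSucc)
    have := hs (vy i.succ)
    have := hxy i
    have := hzy i
    grind
  · rintro ⟨hz, hy⟩
    refine ⟨hs, by grind, by grind, fun i => ?_, fun i => ?_⟩ <;> have := hy i <;> grind

/-- The assignment with spin `1` at `x`, `-1` at `z` and `(-1)^(n-i)` at `y_i`. -/
def alternatingSpin (n : ℕ) : StackV n → ℤ
  | Sum.inl i => (-1) ^ (n + (i : ℕ))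
  | Sum.inr false => 1
  | Sum.inr true => -1

theorem isSpin_alternatingSpin (n : ℕ) : IsSpin (alternatingSpin n) := by
  rintro (i | _ | _)
  · exact neg_one_pow_eq_or ℤ _
  · exact Or.inl rfl
  · exact Or.inr rfl

theorem alternatingSpin_vx_eq (n : ℕ) :
    alternatingSpin n vx = alternatingSpin n (vy (Fin.last n)) := by
  simp [alternatingSpin, vx, vy]

theorem satisfying_alternatingSpin (n : ℕ) : Satisfying (StackFaces n) (alternatingSpin n) := by
  rw [satisfying_stackFaces_iff_alternating (isSpin_alternatingSpin n) (alternatingSpin_vx_eq n)]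
  refine ⟨rfl, fun i => ?_⟩
  simp [alternatingSpin, vy, ← add_assoc, pow_succ]

theorem Satisfying.neg {V : Type*} {F : Finset (Finset V)} {σ : V → ℤ} (h : Satisfying F σ) :
    Satisfying F (-σ) := by
  refine ⟨fun v => ?_, fun f hf hm => h.2 f hf fun u hu v hv => neg_injective (hm u hu v hv)⟩
  have := h.1 v
  simp only [Pi.neg_apply]
  omega

theorem eq_mul_alternatingSpin {n : ℕ} {τ : StackV n → ℤ} (h : Satisfying (StackFaces n) τ)
    (hx : τ vx = τ (vy (Fin.last n))) (v : StackV n) : τ v = τ vx * alternatingSpin n v := by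
  obtain ⟨hz, hy⟩ := (satisfying_stackFaces_iff_alternating h.1 hx).1 h
  rcases v with i | _ | _
  · change τ (vy i) = τ vx * (-1) ^ (n + (i : ℕ))
    induction i using Fin.reverseInduction with
    | last => simp [hx]
    | cast i ih => simp [hy, ih, ← add_assoc, pow_succ]
  · exact (mul_one _).symm
  · exact hz.trans (mul_neg_one _).symm

/-- For every `n ≥ 1` there are exactly two satisfying spin assignments `σ` on the stack
triangulation `Δ_n` with `σ(x) = σ(y_n)`, and they are negatives of each other. -/
theorem stack_exactly_two_satisfying_with_fundamental_edge (n : ℕ) (hn : 1 ≤ n) :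
    ∃ σ : StackV n → ℤ,
      Satisfying (StackFaces n) σ ∧ σ vx = σ (vy (Fin.last n)) ∧ σ ≠ -σ ∧
      ∀ τ : StackV n → ℤ,
        (Satisfying (StackFaces n) τ ∧ τ vx = τ (vy (Fin.last n)))
          ↔ (τ = σ ∨ τ = -σ) := by
  refine ⟨alternatingSpin n, satisfying_alternatingSpin n, alternatingSpin_vx_eq n, fun h => ?_,
    fun τ => ⟨?_, ?_⟩⟩
  · exact absurd (congrFun h vx) (by simp [alternatingSpin, vx])
  · rintro ⟨h, hx⟩
    refine (h.1 vx).imp (fun h1 => ?_) fun h1 => ?_ <;> ext v <;>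
      simp [eq_mul_alternatingSpin h hx v, h1]
  · rintro (rfl | rfl)
    · exact ⟨satisfying_alternatingSpin n, alternatingSpin_vx_eq n⟩
    · exact ⟨(satisfying_alternatingSpin n).neg, congrArg Neg.neg (alternatingSpin_vx_eq n)⟩
end

section
/- For every n ≥ 1, every satisfying spin assignment σ on the stack triangulation Δ_n with σ(x) = σ(y_n) necessarily satisfies σ(z) = −σ(x) and σ(y_{n−1}) = −σ(x). -/
/-- If two vertices of a non-monochromatic triple share their spin, the third has the opposite
spin. -/
theorem IsSpin.eq_neg_of_not_faceMono {V : Type*} [DecidableEq V] {σ : V → ℤ} (hσ : IsSpin σ)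
    {a b c : V} (hf : ¬ FaceMono σ {a, b, c}) {s : ℤ} (h₁ : σ a = s) :
    (σ b = s → σ c = -s) ∧ (σ c = s → σ b = -s) := by
  have key : ¬ (σ b = s ∧ σ c = s) := by
    rintro ⟨h₂, h₃⟩
    exact hf (by simp [FaceMono, h₁, h₂, h₃])
  have ha := hσ a
  have hb := hσ b
  have hc := hσ c
  omega

/-- For every `n ≥ 1`, every satisfying spin assignment `σ` on the stack triangulation `Δ_n`
with `σ(x) = σ(y_n)` necessarily has `σ(z) = -σ(x)` and `σ(y_{n-1}) = -σ(x)`. -/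
theorem stack_satisfying_forced_spins (n : ℕ) (hn : 1 ≤ n) (σ : StackV n → ℤ)
    (hsat : Satisfying (StackFaces n) σ) (hxy : σ vx = σ (vy (Fin.last n))) :
    σ vz = -σ vx ∧ σ (vy ⟨n - 1, by omega⟩) = -σ vx := by
  obtain ⟨m, rfl⟩ := Nat.exists_eq_add_of_le' hn
  obtain ⟨hσ, hF⟩ := hsat
  have hz : ¬ FaceMono σ {vx, vy (Fin.last (m + 1)), vz} := hF _ (by simp [StackFaces])
  have hy : ¬ FaceMono σ {vx, vy (Fin.last m).castSucc, vy (Fin.last m).succ} :=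
    hF _ (Finset.mem_union_left _ (Finset.mem_union_right _
      (Finset.mem_image_of_mem _ (Finset.mem_univ (Fin.last m)))))
  exact ⟨(hσ.eq_neg_of_not_faceMono hz rfl).1 hxy.symm,
    (hσ.eq_neg_of_not_faceMono hy rfl).2 hxy.symm⟩
end

section
/- Let G = (V,E) be a finite simple graph and F a family of 3-element subsets of V, each spanning a triangle of G, such that every edge of G lies in exactly two members of F. If σ : V → {−1,+1} is a satisfying spin assignment (no face is monochromatic under σ), then σ minimizes the antiferromagnetic Hamiltonian H over all spin assignments, i.e., H(σ) ≤ H(τ) for every τ : V → {−1,+1}. -/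
open scoped Classical

/-- An edge is monochromatic (frustrated) under `σ` when both of its ends get the same spin. -/
def EdgeMono {V : Type*} (σ : V → ℤ) (e : Sym2 V) : Prop :=
  ∀ u ∈ e, ∀ v ∈ e, σ u = σ v

/-- Double counting: if every edge lies in exactly two faces, then twice the Hamiltonian is the
sum over the faces of the energies of the edges contained in them. -/
theorem two_mul_hamiltonian {V : Type*} (E : Finset (Sym2 V)) (F : Finset (Finset V))
    (htwo : ∀ e ∈ E, (F.filter (fun f => ∀ v ∈ e, v ∈ f)).card = 2) (σ : V → ℤ) :
    2 * Hamiltonian E σ =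
      ∑ f ∈ F, Hamiltonian (E.filter (fun e => ∀ v ∈ e, v ∈ f)) σ := by
  unfold Hamiltonian
  simp only [Finset.sum_filter]
  rw [Finset.sum_comm, Finset.mul_sum]
  refine Finset.sum_congr rfl fun e he => ?_
  rw [← Finset.sum_filter, Finset.sum_const, htwo e he, nsmul_eq_mul, Nat.cast_ofNat]

/-- The edges contained in a triangle `{a, b, c}` are its three sides. -/
theorem filter_subset_triangle {V : Type*} [DecidableEq V] (E : Finset (Sym2 V))
    (hsimple : ∀ e ∈ E, ¬ e.IsDiag) {a b c : V}
    (hab : s(a, b) ∈ E) (hac : s(a, c) ∈ E) (hbc : s(b, c) ∈ E) :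
    E.filter (fun e => ∀ v ∈ e, v ∈ ({a, b, c} : Finset V)) =
      {s(a, b), s(a, c), s(b, c)} := by
  ext e
  induction e using Sym2.ind with
  | _ x y =>
    simp only [Finset.mem_filter, Finset.mem_insert, Finset.mem_singleton, Sym2.mem_iff]
    constructor
    · rintro ⟨he, h⟩
      have hxy : x ≠ y := fun h => hsimple _ he (Sym2.mk_isDiag_iff.2 h)
      rcases h x (Or.inl rfl) with rfl | rfl | rfl <;>
        rcases h y (Or.inr rfl) with rfl | rfl | rfl <;>
        simp_all [Sym2.eq_swap]
    · rintro (h | h | h) <;> rw [h] <;> refine ⟨by assumption, fun v hv => ?_⟩ <;>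
        (rw [← Sym2.mem_iff, h, Sym2.mem_iff] at hv; tauto)

/-- The energy carried by a triangular face is the sum over its three sides. -/
theorem hamiltonian_triangle {V : Type*} [DecidableEq V] (E : Finset (Sym2 V))
    (hsimple : ∀ e ∈ E, ¬ e.IsDiag) {a b c : V} (nab : a ≠ b) (nac : a ≠ c) (nbc : b ≠ c)
    (hab : s(a, b) ∈ E) (hac : s(a, c) ∈ E) (hbc : s(b, c) ∈ E) (σ : V → ℤ) :
    Hamiltonian (E.filter (fun e => ∀ v ∈ e, v ∈ ({a, b, c} : Finset V))) σ =
      σ a * σ b + σ a * σ c + σ b * σ c := by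
  rw [filter_subset_triangle E hsimple hab hac hbc, Hamiltonian, Finset.sum_insert,
    Finset.sum_insert, Finset.sum_singleton]
  · simp only [Sym2.lift_mk]
    ring
  · simp [nab, nac]
  · simp [nac, nbc]

/-- Among all spin assignments, a non-monochromatic one has the least energy on a triangle. -/
theorem triangle_energy_le {V : Type*} {σ τ : V → ℤ} (hσ : IsSpin σ) (hτ : IsSpin τ) {a b c : V}
    (h : ¬ (σ a = σ b ∧ σ b = σ c)) :
    σ a * σ b + σ a * σ c + σ b * σ c ≤ τ a * τ b + τ a * τ c + τ b * τ c := by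
  have hlow : σ a * σ b + σ a * σ c + σ b * σ c = -1 := by
    rcases hσ a with ha | ha <;> rcases hσ b with hb | hb <;> rcases hσ c with hc | hc <;>
      simp_all
  rw [hlow]
  rcases hτ a with ha | ha <;> rcases hτ b with hb | hb <;> rcases hτ c with hc | hc <;>
    simp [ha, hb, hc]

/-- Let `G = (V, E)` be a finite simple graph and `F` a family of 3-element subsets of `V`,
each spanning a triangle of `G`, such that every edge lies in exactly two faces.  If `σ` is a
satisfying spin assignment (no face is monochromatic), then `σ` minimizes the
antiferromagnetic Hamiltonian over all spin assignments. -/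
theorem satisfying_is_groundstate {V : Type*} [DecidableEq V]
    (E : Finset (Sym2 V)) (F : Finset (Finset V))
    (hsimple : ∀ e ∈ E, ¬ e.IsDiag)
    (hface : ∀ f ∈ F, f.card = 3 ∧ ∀ u ∈ f, ∀ v ∈ f, u ≠ v → s(u, v) ∈ E)
    (htwo : ∀ e ∈ E, (F.filter (fun f => ∀ v ∈ e, v ∈ f)).card = 2)
    (σ : V → ℤ) (hσ : IsSpin σ) (hsat : ∀ f ∈ F, ¬ FaceMono σ f) :
    ∀ τ : V → ℤ, IsSpin τ → Hamiltonian E σ ≤ Hamiltonian E τ := by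
  intro τ hτ
  have hle : 2 * Hamiltonian E σ ≤ 2 * Hamiltonian E τ := by
    rw [two_mul_hamiltonian E F (by convert htwo) σ, two_mul_hamiltonian E F (by convert htwo) τ]
    refine Finset.sum_le_sum fun f hf => ?_
    obtain ⟨hcard, hE⟩ := hface f hf
    have hns := hsat f hf
    obtain ⟨a, b, c, nab, nac, nbc, rfl⟩ := Finset.card_eq_three.1 hcard
    have hab := hE a (by simp) b (by simp) nab
    have hac := hE a (by simp) c (by simp) nac
    have hbc := hE b (by simp) c (by simp) nbc
    have hmono : ¬ (σ a = σ b ∧ σ b = σ c) := by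
      rintro ⟨h₁, h₂⟩
      exact hns (by simp [FaceMono, h₁, h₂])
    have key := triangle_energy_le hσ hτ hmono
    rw [← hamiltonian_triangle E hsimple nab nac nbc hab hac hbc σ,
      ← hamiltonian_triangle E hsimple nab nac nbc hab hac hbc τ] at key
    convert key
  linarith
end

section
/- Let G = (V,E) be a finite simple graph and F a family of 3-element subsets of V, each spanning a triangle of G, such that every edge of G lies in exactly two members of F. If σ : V → {−1,+1} is a satisfying spin assignment (no face is monochromatic under σ), then the number of edges of G that are monochromatic under σ equals |F|/2; equivalently, H(σ) = |F| − |E|. -/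
open scoped Classical

/-- In a triangle `{a, b, c}` with `σ a = σ b ≠ σ c`, the edge `s(a, b)` is the only
monochromatic one. -/
theorem filter_edgeMono_subset_eq_singleton {V : Type*} [DecidableEq V]
    {E : Finset (Sym2 V)} (hsimple : ∀ e ∈ E, ¬ e.IsDiag) {σ : V → ℤ} {f : Finset V}
    {a b c : V} (hf : f = {a, b, c}) (hE : s(a, b) ∈ E) (hab : σ a = σ b)
    (hac : σ a ≠ σ c) :
    (E.filter (fun e => EdgeMono σ e)).filter (fun e => ∀ v ∈ e, v ∈ f) = {s(a, b)} := by
  subst hf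
  ext e
  induction e using Sym2.ind with
  | _ x y =>
    rw [Finset.mem_filter, Finset.mem_filter, Finset.mem_singleton]
    simp only [EdgeMono, Sym2.mem_iff, Finset.mem_insert, Finset.mem_singleton]
    constructor
    · rintro ⟨⟨he, hm⟩, hs⟩
      have hxy : x ≠ y := fun h => hsimple _ he (Sym2.mk_isDiag_iff.2 h)
      have hσxy := hm x (Or.inl rfl) y (Or.inr rfl)
      rw [Sym2.eq_iff]
      have hx := hs x (Or.inl rfl)
      have hy := hs y (Or.inr rfl)
      clear hs hm hsimple
      grind
    · intro h
      rw [h]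
      rcases Sym2.eq_iff.1 h with ⟨rfl, rfl⟩ | ⟨rfl, rfl⟩ <;> grind

/-- A non-monochromatic triangle contains exactly one monochromatic edge. -/
theorem card_filter_edgeMono_subset_eq_one {V : Type*} [DecidableEq V]
    {E : Finset (Sym2 V)} (hsimple : ∀ e ∈ E, ¬ e.IsDiag) {σ : V → ℤ} (hσ : IsSpin σ)
    {f : Finset V} (hcard : f.card = 3) (hf : ∀ u ∈ f, ∀ v ∈ f, u ≠ v → s(u, v) ∈ E)
    (hsat : ¬ FaceMono σ f) :
    ((E.filter (fun e => EdgeMono σ e)).filter (fun e => ∀ v ∈ e, v ∈ f)).card = 1 := by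
  obtain ⟨a, b, c, hab, hac, hbc, rfl⟩ := Finset.card_eq_three.1 hcard
  have hEab : s(a, b) ∈ E := hf a (by simp) b (by simp) hab
  have hEac : s(a, c) ∈ E := hf a (by simp) c (by simp) hac
  have hEbc : s(b, c) ∈ E := hf b (by simp) c (by simp) hbc
  rw [Finset.card_eq_one]
  by_cases h₁ : σ a = σ b
  · refine ⟨_, filter_edgeMono_subset_eq_singleton hsimple rfl hEab h₁ fun h => hsat ?_⟩
    simp [FaceMono, ← h₁, ← h]
  · by_cases h₂ : σ a = σ c
    · exact ⟨_, filter_edgeMono_subset_eq_singleton hsimple (by grind) hEac h₂ h₁⟩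
    · have h₃ : σ b = σ c := by
        rcases hσ a with h | h <;> rcases hσ b with h' | h' <;>
          rcases hσ c with h'' | h'' <;> simp_all
      exact ⟨_, filter_edgeMono_subset_eq_singleton hsimple (by grind) hEbc h₃ (Ne.symm h₁)⟩

/-- The Hamiltonian of a spin assignment counts monochromatic edges with sign `+1` and all other
edges with sign `-1`. -/
theorem hamiltonian_eq_two_mul_card_sub_card {V : Type*} (E : Finset (Sym2 V))
    {σ : V → ℤ} (hσ : IsSpin σ) :
    Hamiltonian E σ = 2 * ((E.filter (fun e => EdgeMono σ e)).card : ℤ) - (E.card : ℤ) := by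
  have key : ∀ e ∈ E, Sym2.lift ⟨fun u v => σ u * σ v, fun u v => mul_comm _ _⟩ e =
      2 * (if EdgeMono σ e then (1 : ℤ) else 0) - 1 := by
    intro e _
    induction e using Sym2.ind with
    | _ x y =>
      rcases hσ x with h | h <;> rcases hσ y with h' | h' <;>
        simp [EdgeMono, h, h']
  rw [Hamiltonian, Finset.sum_congr rfl key, Finset.sum_sub_distrib, ← Finset.mul_sum,
    Finset.sum_boole]
  simp

/-- Let `G = (V, E)` be a finite simple graph and `F` a family of 3-element subsets of `V`,
each spanning a triangle of `G`, such that every edge lies in exactly two faces.  If `σ` is a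
satisfying spin assignment (no face is monochromatic), then the number of monochromatic
edges under `σ` is `|F| / 2`; equivalently, `H(σ) = |F| - |E|`. -/
theorem satisfying_mono_edge_count {V : Type*} [DecidableEq V]
    (E : Finset (Sym2 V)) (F : Finset (Finset V))
    (hsimple : ∀ e ∈ E, ¬ e.IsDiag)
    (hface : ∀ f ∈ F, f.card = 3 ∧ ∀ u ∈ f, ∀ v ∈ f, u ≠ v → s(u, v) ∈ E)
    (htwo : ∀ e ∈ E, (F.filter (fun f => ∀ v ∈ e, v ∈ f)).card = 2)
    (σ : V → ℤ) (hσ : IsSpin σ) (hsat : ∀ f ∈ F, ¬ FaceMono σ f) :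
    2 * (E.filter (fun e => EdgeMono σ e)).card = F.card ∧
    Hamiltonian E σ = (F.card : ℤ) - (E.card : ℤ) := by
  have hcount : 2 * (E.filter (fun e => EdgeMono σ e)).card = F.card := by
    have h := Finset.sum_card_bipartiteAbove_eq_sum_card_bipartiteBelow
      (s := E.filter (fun e => EdgeMono σ e)) (t := F)
      (fun (e : Sym2 V) (f : Finset V) => ∀ v ∈ e, v ∈ f)
    have hl : ∀ e ∈ E.filter (fun e => EdgeMono σ e),
        (F.bipartiteAbove (fun (e : Sym2 V) (f : Finset V) => ∀ v ∈ e, v ∈ f) e).card = 2 := by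
      intro e he
      rw [← htwo e (Finset.mem_filter.1 he).1, Finset.bipartiteAbove]
    have hr : ∀ f ∈ F, ((E.filter (fun e => EdgeMono σ e)).bipartiteBelow
        (fun (e : Sym2 V) (f : Finset V) => ∀ v ∈ e, v ∈ f) f).card = 1 := by
      intro f hf
      rw [← card_filter_edgeMono_subset_eq_one hsimple hσ (hface f hf).1 (hface f hf).2
        (hsat f hf), Finset.bipartiteBelow]
    rw [Finset.sum_congr rfl hl, Finset.sum_congr rfl hr] at h
    simpa [mul_comm] using h
  refine ⟨hcount, ?_⟩
  rw [hamiltonian_eq_two_mul_card_sub_card E hσ, ← hcount]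
  push_cast
  rfl
end

section
/- Gluing an augmenting triangulation onto a hole preserves uniqueness: let V₁ and V₂ be finite vertex sets with V₁ ∩ V₂ = {x, y, z} (three distinct vertices), let F₁ be a family of 3-element subsets of V₁ and F₂ a family of 3-element subsets of V₂. Assume: (i) the spin assignments on V₁ under which no member of F₁ is monochromatic are exactly a pair {σ₀, −σ₀}, where σ₀(x) = σ₀(y) and σ₀(z) = −σ₀(x); (ii) the spin assignments τ on V₂ with τ(x) = τ(y) under which no member of F₂ is monochromatic are exactly a pair {τ₀, −τ₀}, and τ₀(z) = −τ₀(x). Then the spin assignments ρ on V₁ ∪ V₂ under which no member of F₁ ∪ F₂ is monochromatic are exactly one pair {ρ₀, −ρ₀}, where ρ₀ agrees with σ₀ on V₁ (up to the global sign). -/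
/-- Gluing an augmenting triangulation onto a hole preserves uniqueness.  Let `V₁, V₂` be
finite vertex sets with `V₁ ∩ V₂ = {x, y, z}` (three distinct vertices); `F₁` (resp. `F₂`) a
family of 3-element subsets of `V₁` (resp. `V₂`).  Assume (i) the spin assignments on `V₁`
under which no member of `F₁` is monochromatic are exactly the pair `{σ₀, -σ₀}`, where
`σ₀ x = σ₀ y` and `σ₀ z = -σ₀ x`; (ii) the spin assignments `τ` on `V₂` with `τ x = τ y`
under which no member of `F₂` is monochromatic are exactly the pair `{τ₀, -τ₀}`, where
`τ₀ z = -τ₀ x`.  Then the spin assignments on `V₁ ∪ V₂` under which no member of `F₁ ∪ F₂`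
is monochromatic are exactly one pair `{ρ₀, -ρ₀}`, where `ρ₀` agrees with `σ₀` on `V₁`. -/
theorem glue_augmenting_preserves_uniqueness {V : Type*} [DecidableEq V]
    (V₁ V₂ : Finset V) (x y z : V)
    (hxy : x ≠ y) (hxz : x ≠ z) (hyz : y ≠ z)
    (hinter : V₁ ∩ V₂ = {x, y, z})
    (F₁ F₂ : Finset (Finset V))
    (hF₁ : ∀ f ∈ F₁, f.card = 3 ∧ f ⊆ V₁)
    (hF₂ : ∀ f ∈ F₂, f.card = 3 ∧ f ⊆ V₂)
    (σ₀ : V → ℤ) (hσ₀ : IsSpin σ₀)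
    (hσ₀xy : σ₀ x = σ₀ y) (hσ₀z : σ₀ z = -σ₀ x)
    (huniq₁ : ∀ σ : V → ℤ, IsSpin σ →
      ((∀ f ∈ F₁, ¬ FaceMono σ f) ↔
        ((∀ v ∈ V₁, σ v = σ₀ v) ∨ (∀ v ∈ V₁, σ v = -σ₀ v))))
    (τ₀ : V → ℤ) (hτ₀ : IsSpin τ₀)
    (hτ₀xy : τ₀ x = τ₀ y) (hτ₀z : τ₀ z = -τ₀ x)
    (huniq₂ : ∀ τ : V → ℤ, IsSpin τ → τ x = τ y →
      ((∀ f ∈ F₂, ¬ FaceMono τ f) ↔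
        ((∀ v ∈ V₂, τ v = τ₀ v) ∨ (∀ v ∈ V₂, τ v = -τ₀ v)))) :
    ∃ ρ₀ : V → ℤ, IsSpin ρ₀ ∧ (∀ v ∈ V₁, ρ₀ v = σ₀ v) ∧
      ∀ ρ : V → ℤ, IsSpin ρ →
        ((∀ f ∈ F₁ ∪ F₂, ¬ FaceMono ρ f) ↔
          ((∀ v ∈ V₁ ∪ V₂, ρ v = ρ₀ v) ∨ (∀ v ∈ V₁ ∪ V₂, ρ v = -ρ₀ v))) := by
  obtain ⟨τ, hτ, hτx, hτy, hτz, huniq⟩ : ∃ τ : V → ℤ, IsSpin τ ∧ τ x = σ₀ x ∧ τ y = σ₀ y ∧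
      τ z = σ₀ z ∧ ∀ ρ : V → ℤ, IsSpin ρ → ρ x = ρ y →
        ((∀ f ∈ F₂, ¬ FaceMono ρ f) ↔
          ((∀ v ∈ V₂, ρ v = τ v) ∨ (∀ v ∈ V₂, ρ v = -τ v))) := by
    by_cases h : τ₀ x = σ₀ x
    · exact ⟨τ₀, hτ₀, h, by omega, by omega, huniq₂⟩
    · have h' : -τ₀ x = σ₀ x := by
        have h₁ := hσ₀ x
        have h₂ := hτ₀ x
        omega
      refine ⟨fun v => -τ₀ v, fun v => ?_, h', ?_, ?_, fun ρ hρ hρxy => ?_⟩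
      · have := hτ₀ v
        dsimp only
        omega
      · dsimp only
        omega
      · dsimp only
        omega
      · simpa only [neg_neg, or_comm] using huniq₂ ρ hρ hρxy
  have mem_inter : ∀ v, v ∈ V₁ ∧ v ∈ V₂ ↔ v = x ∨ v = y ∨ v = z := fun v => by
    rw [← Finset.mem_inter, hinter]
    simp
  obtain ⟨hx₁, hx₂⟩ := (mem_inter x).2 (by simp)
  obtain ⟨hy₁, hy₂⟩ := (mem_inter y).2 (by simp)
  obtain ⟨ρ₀, hρ₀, hρ₁, hρ₂⟩ : ∃ ρ₀ : V → ℤ, IsSpin ρ₀ ∧ (∀ v ∈ V₁, ρ₀ v = σ₀ v) ∧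
      ∀ v ∈ V₂, ρ₀ v = τ v := by
    refine ⟨fun v => if v ∈ V₁ then σ₀ v else τ v, fun v => ?_, fun v hv => if_pos hv,
      fun v hv => ?_⟩
    · dsimp only
      split_ifs
      exacts [hσ₀ v, hτ v]
    · dsimp only
      split_ifs with hv₁
      · obtain rfl | rfl | rfl := (mem_inter v).1 ⟨hv₁, hv⟩
        exacts [hτx.symm, hτy.symm, hτz.symm]
      · rfl
  refine ⟨ρ₀, hρ₀, hρ₁, fun ρ hρ => ?_⟩
  have union_iff : (∀ f ∈ F₁ ∪ F₂, ¬ FaceMono ρ f) ↔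
      (∀ f ∈ F₁, ¬ FaceMono ρ f) ∧ ∀ f ∈ F₂, ¬ FaceMono ρ f := by
    simp only [Finset.mem_union, or_imp, forall_and]
  have hσx := hσ₀ x
  rw [union_iff, huniq₁ ρ hρ]
  constructor
  · rintro ⟨h₁, h₂⟩
    have hρxy : ρ x = ρ y := by
      rcases h₁ with h₁ | h₁ <;> rw [h₁ x hx₁, h₁ y hy₁, hσ₀xy]
    rw [huniq ρ hρ hρxy] at h₂
    rcases h₁ with h₁ | h₁ <;> rcases h₂ with h₂ | h₂
    · left
      intro v hv
      rcases Finset.mem_union.1 hv with hv | hv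
      · rw [h₁ v hv, hρ₁ v hv]
      · rw [h₂ v hv, hρ₂ v hv]
    · have := h₁ x hx₁
      have := h₂ x hx₂
      omega
    · have := h₁ x hx₁
      have := h₂ x hx₂
      omega
    · right
      intro v hv
      rcases Finset.mem_union.1 hv with hv | hv
      · rw [h₁ v hv, hρ₁ v hv]
      · rw [h₂ v hv, hρ₂ v hv]
  · intro h
    have h₁ : (∀ v ∈ V₁, ρ v = σ₀ v) ∨ ∀ v ∈ V₁, ρ v = -σ₀ v :=
      h.imp (fun h v hv => by rw [h v (Finset.mem_union_left _ hv), hρ₁ v hv])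
        (fun h v hv => by rw [h v (Finset.mem_union_left _ hv), hρ₁ v hv])
    have hρxy : ρ x = ρ y := by
      rcases h₁ with h₁ | h₁ <;> rw [h₁ x hx₁, h₁ y hy₁, hσ₀xy]
    refine ⟨h₁, (huniq ρ hρ hρxy).2 ?_⟩
    exact h.imp (fun h v hv => by rw [h v (Finset.mem_union_right _ hv), hρ₂ v hv])
      (fun h v hv => by rw [h v (Finset.mem_union_right _ hv), hρ₂ v hv])
end

section
/- Gluing two connectors along connection cycles preserves uniqueness: let V₁ and V₂ be finite vertex sets with V₁ ∩ V₂ = {x, y, z} (three distinct vertices), let F₁ be a family of 3-element subsets of V₁ and F₂ a family of 3-element subsets of V₂. Assume: (i) the spin assignments on V₁ under which no member of F₁ is monochromatic are exactly a pair {σ₀, −σ₀}, where σ₀(x) = σ₀(y) and σ₀(z) = −σ₀(x); (ii) the spin assignments on V₂ under which no member of F₂ is monochromatic are exactly a pair {τ₀, −τ₀}, where τ₀(x) = τ₀(y) and τ₀(z) = −τ₀(x). Then the spin assignments ρ on V₁ ∪ V₂ under which no member of F₁ ∪ F₂ is monochromatic are exactly one pair {ρ₀, −ρ₀}. -/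
/-- If `σ₀` and `τ₀` agree on `V₁ ∩ V₂` and do not vanish at some common vertex, then the functions
equal to `±σ₀` on `V₁` and to `±τ₀` on `V₂` are exactly those equal, up to a global sign, to the
function glued from `σ₀` and `τ₀`. -/
theorem eq_or_eq_neg_piecewise_iff {V : Type*} [DecidableEq V] {V₁ V₂ : Finset V} {x : V}
    {σ₀ τ₀ : V → ℤ} (hx : x ∈ V₁ ∩ V₂) (hx₀ : σ₀ x ≠ 0)
    (hagree : ∀ v ∈ V₁ ∩ V₂, σ₀ v = τ₀ v) (ρ : V → ℤ) :
    (((∀ v ∈ V₁, ρ v = σ₀ v) ∨ (∀ v ∈ V₁, ρ v = -σ₀ v)) ∧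
        ((∀ v ∈ V₂, ρ v = τ₀ v) ∨ (∀ v ∈ V₂, ρ v = -τ₀ v))) ↔
      ((∀ v ∈ V₁ ∪ V₂, ρ v = V₁.piecewise σ₀ τ₀ v) ∨
        (∀ v ∈ V₁ ∪ V₂, ρ v = -V₁.piecewise σ₀ τ₀ v)) := by
  have hfst : ∀ v ∈ V₁, V₁.piecewise σ₀ τ₀ v = σ₀ v := fun v hv =>
    Finset.piecewise_eq_of_mem V₁ σ₀ τ₀ hv
  have hsnd : ∀ v ∈ V₂, V₁.piecewise σ₀ τ₀ v = τ₀ v := by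
    intro v hv
    by_cases h : v ∈ V₁
    · rw [hfst v h, hagree v (Finset.mem_inter.2 ⟨h, hv⟩)]
    · exact Finset.piecewise_eq_of_notMem V₁ σ₀ τ₀ h
  have hxagree := hagree x hx
  obtain ⟨hx₁, hx₂⟩ := Finset.mem_inter.1 hx
  constructor
  · rintro ⟨h₁ | h₁, h₂ | h₂⟩
    · left; grind
    · have := h₁ x hx₁; have := h₂ x hx₂; omega
    · have := h₁ x hx₁; have := h₂ x hx₂; omega
    · right; grind
  · rintro (h | h)
    · exact ⟨Or.inl (by grind), Or.inl (by grind)⟩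
    · exact ⟨Or.inr (by grind), Or.inr (by grind)⟩

/-- Gluing for connectors whose reference spin assignments agree on the common vertices. -/
theorem exists_glued_spin_of_agree {V : Type*} [DecidableEq V]
    {V₁ V₂ : Finset V} {x : V} {F₁ F₂ : Finset (Finset V)} {σ₀ τ₀ : V → ℤ}
    (hσ₀ : IsSpin σ₀) (hτ₀ : IsSpin τ₀) (hx : x ∈ V₁ ∩ V₂)
    (hagree : ∀ v ∈ V₁ ∩ V₂, σ₀ v = τ₀ v)
    (huniq₁ : ∀ σ : V → ℤ, IsSpin σ →
      ((∀ f ∈ F₁, ¬ FaceMono σ f) ↔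
        ((∀ v ∈ V₁, σ v = σ₀ v) ∨ (∀ v ∈ V₁, σ v = -σ₀ v))))
    (huniq₂ : ∀ τ : V → ℤ, IsSpin τ →
      ((∀ f ∈ F₂, ¬ FaceMono τ f) ↔
        ((∀ v ∈ V₂, τ v = τ₀ v) ∨ (∀ v ∈ V₂, τ v = -τ₀ v)))) :
    ∃ ρ₀ : V → ℤ, IsSpin ρ₀ ∧
      ∀ ρ : V → ℤ, IsSpin ρ →
        ((∀ f ∈ F₁ ∪ F₂, ¬ FaceMono ρ f) ↔
          ((∀ v ∈ V₁ ∪ V₂, ρ v = ρ₀ v) ∨ (∀ v ∈ V₁ ∪ V₂, ρ v = -ρ₀ v))) := by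
  refine ⟨V₁.piecewise σ₀ τ₀, fun v => ?_, fun ρ hρ => ?_⟩
  · by_cases h : v ∈ V₁
    · simpa [h] using hσ₀ v
    · simpa [h] using hτ₀ v
  · have hx₀ : σ₀ x ≠ 0 := by rcases hσ₀ x with h | h <;> simp [h]
    rw [← eq_or_eq_neg_piecewise_iff hx hx₀ hagree, ← huniq₁ ρ hρ, ← huniq₂ ρ hρ,
      Finset.forall_mem_union]

/-- Gluing two connectors along connection cycles preserves uniqueness.  Let `V₁, V₂` be
finite vertex sets with `V₁ ∩ V₂ = {x, y, z}` (three distinct vertices); `F₁` (resp. `F₂`) a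
family of 3-element subsets of `V₁` (resp. `V₂`).  Assume (i) the spin assignments on `V₁`
under which no member of `F₁` is monochromatic are exactly the pair `{σ₀, -σ₀}`, where
`σ₀ x = σ₀ y` and `σ₀ z = -σ₀ x`; (ii) the spin assignments on `V₂` under which no member of
`F₂` is monochromatic are exactly the pair `{τ₀, -τ₀}`, where `τ₀ x = τ₀ y` and
`τ₀ z = -τ₀ x`.  Then the spin assignments on `V₁ ∪ V₂` under which no member of `F₁ ∪ F₂`
is monochromatic are exactly one pair `{ρ₀, -ρ₀}`. -/
theorem glue_connectors_preserves_uniqueness {V : Type*} [DecidableEq V]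
    (V₁ V₂ : Finset V) (x y z : V)
    (hxy : x ≠ y) (hxz : x ≠ z) (hyz : y ≠ z)
    (hinter : V₁ ∩ V₂ = {x, y, z})
    (F₁ F₂ : Finset (Finset V))
    (hF₁ : ∀ f ∈ F₁, f.card = 3 ∧ f ⊆ V₁)
    (hF₂ : ∀ f ∈ F₂, f.card = 3 ∧ f ⊆ V₂)
    (σ₀ : V → ℤ) (hσ₀ : IsSpin σ₀)
    (hσ₀xy : σ₀ x = σ₀ y) (hσ₀z : σ₀ z = -σ₀ x)
    (huniq₁ : ∀ σ : V → ℤ, IsSpin σ →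
      ((∀ f ∈ F₁, ¬ FaceMono σ f) ↔
        ((∀ v ∈ V₁, σ v = σ₀ v) ∨ (∀ v ∈ V₁, σ v = -σ₀ v))))
    (τ₀ : V → ℤ) (hτ₀ : IsSpin τ₀)
    (hτ₀xy : τ₀ x = τ₀ y) (hτ₀z : τ₀ z = -τ₀ x)
    (huniq₂ : ∀ τ : V → ℤ, IsSpin τ →
      ((∀ f ∈ F₂, ¬ FaceMono τ f) ↔
        ((∀ v ∈ V₂, τ v = τ₀ v) ∨ (∀ v ∈ V₂, τ v = -τ₀ v)))) :
    ∃ ρ₀ : V → ℤ, IsSpin ρ₀ ∧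
      ∀ ρ : V → ℤ, IsSpin ρ →
        ((∀ f ∈ F₁ ∪ F₂, ¬ FaceMono ρ f) ↔
          ((∀ v ∈ V₁ ∪ V₂, ρ v = ρ₀ v) ∨ (∀ v ∈ V₁ ∪ V₂, ρ v = -ρ₀ v))) := by
  have hx : x ∈ V₁ ∩ V₂ := by simp [hinter]
  have hsign : τ₀ x = σ₀ x ∨ τ₀ x = -σ₀ x := by
    rcases hσ₀ x with h | h <;> rcases hτ₀ x with h' | h' <;> simp [h, h']
  rcases hsign with hs | hs
  · refine exists_glued_spin_of_agree hσ₀ hτ₀ hx (fun v hv => ?_) huniq₁ huniq₂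
    simp only [hinter, Finset.mem_insert, Finset.mem_singleton] at hv
    rcases hv with rfl | rfl | rfl <;> omega
  · refine exists_glued_spin_of_agree (τ₀ := fun v => -τ₀ v) hσ₀ (fun v => ?_) hx
      (fun v hv => ?_) huniq₁ (fun τ hτ => ?_)
    · have := hτ₀ v
      dsimp only
      omega
    · simp only [hinter, Finset.mem_insert, Finset.mem_singleton] at hv
      rcases hv with rfl | rfl | rfl <;> omega
    · simpa only [neg_neg, or_comm] using huniq₂ τ hτ
end

section
/- Supporting triangulations of the torus exist: there is a combinatorial triangulation (G, F) of the torus and two faces f₁, f₂ ∈ F with f₁ ∩ f₂ = ∅ such that the spin assignments on V under which no member of F \ {f₁, f₂} is monochromatic form exactly one pair {σ, −σ}, and moreover neither f₁ nor f₂ is monochromatic under σ. -/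
open scoped Classical

namespace SupportingTorus

/-- The faces of a triangulation of the torus with eight vertices, each listed in the cyclic
order given by an orientation of the torus. -/
def orientedFaces : List (Fin 8 × Fin 8 × Fin 8) :=
  [(1, 2, 4), (2, 3, 5), (3, 4, 6), (4, 5, 0), (5, 6, 1), (6, 0, 2), (0, 3, 2), (1, 4, 3),
    (2, 5, 4), (3, 6, 5), (4, 0, 6), (6, 2, 1), (1, 3, 7), (3, 0, 7), (7, 0, 5), (5, 1, 7)]

/-- The vertex set of an oriented face. -/
def vertices (t : Fin 8 × Fin 8 × Fin 8) : Finset (Fin 8) := {t.1, t.2.1, t.2.2}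

/-- The faces of the triangulation. -/
def faces : Finset (Finset (Fin 8)) := (orientedFaces.map vertices).toFinset

/-- The edges of the triangulation. -/
def edges : Finset (Sym2 (Fin 8)) :=
  (orientedFaces.flatMap fun t => [s(t.1, t.2.1), s(t.2.1, t.2.2), s(t.2.2, t.1)]).toFinset

/-- The neighbours of each vertex, in the cyclic order of its link. -/
def linkCycle : Fin 8 → List (Fin 8) :=
  ![[2, 6, 4, 5, 7, 3], [2, 4, 3, 7, 5, 6], [0, 3, 5, 4, 1, 6], [0, 7, 1, 4, 6, 5, 2],
    [0, 6, 3, 1, 2, 5], [0, 4, 2, 3, 6, 1, 7], [0, 2, 1, 5, 3, 4], [0, 5, 1, 3]]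

/-- The faces at `v`, in cyclic order. -/
def star (v : Fin 8) : List (Finset (Fin 8)) :=
  ((linkCycle v).zip ((linkCycle v).rotate 1)).map fun p => {v, p.1, p.2}

/-- The successor of a vertex in an oriented face. -/
def faceSucc (t : Fin 8 × Fin 8 × Fin 8) (v : Fin 8) : Fin 8 :=
  if v = t.1 then t.2.1 else if v = t.2.1 then t.2.2 else t.1

/-- The successor map on a face induced by `orientedFaces`. -/
def succ (f : Finset (Fin 8)) (v : Fin 8) : Fin 8 :=
  ((orientedFaces.find? fun t => vertices t = f).map fun t => faceSucc t v).getD v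

/-- The spin assignment with value `1` where `b` is true and `-1` elsewhere. -/
def spin (b : Fin 8 → Bool) (v : Fin 8) : ℤ := if b v then 1 else -1

/-- The vertices of spin `1` in the unique pair of assignments without monochromatic faces
other than possibly the two exceptional ones. -/
def up : Fin 8 → Bool := ![false, false, true, false, true, false, true, true]

theorem spin_eq_spin_iff (b : Fin 8 → Bool) (u v : Fin 8) : spin b u = spin b v ↔ b u = b v := by
  unfold spin
  cases b u <;> cases b v <;> simp

theorem spin_injective : Function.Injective spin := by
  intro b c h
  funext v
  have := congrFun h v
  unfold spin at this
  revert this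
  cases b v <;> cases c v <;> simp

theorem neg_spin (b : Fin 8 → Bool) : -spin b = spin fun v => !b v := by
  funext v
  cases h : b v <;> simp [spin, h]

theorem isSpin_spin (b : Fin 8 → Bool) : IsSpin (spin b) := by
  intro v
  unfold spin
  cases b v <;> simp

theorem exists_eq_spin {τ : Fin 8 → ℤ} (hτ : IsSpin τ) : ∃ b, τ = spin b := by
  refine ⟨fun v => decide (τ v = 1), funext fun v => ?_⟩
  rcases hτ v with h | h <;> simp [spin, h]

theorem faceMono_spin_iff (b : Fin 8 → Bool) (f : Finset (Fin 8)) :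
    FaceMono (spin b) f ↔ ∀ u ∈ f, ∀ v ∈ f, b u = b v := by
  simp only [FaceMono, spin_eq_spin_iff]

theorem linkIsCycle_faces (v : Fin 8) : LinkIsCycle faces v := by
  have hne : ∀ v, star v ≠ [] := by decide +kernel
  have hnodup : ∀ v, (star v).Nodup := by decide +kernel
  have hmem : ∀ v, (star v).toFinset = faces.filter (v ∈ ·) := by decide +kernel
  have hchain : ∀ v, List.IsChain
      (fun f g : Finset (Fin 8) => f ≠ g ∧ ∃ u, u ≠ v ∧ u ∈ f ∧ u ∈ g) (star v) := by
    decide +kernel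
  have hlast : ∀ v, ∀ h : star v ≠ [],
      (star v).getLast h ≠ (star v).head h ∧
        ∃ u, u ≠ v ∧ u ∈ (star v).getLast h ∧ u ∈ (star v).head h := by
    decide +kernel
  refine ⟨star v, hne v, hnodup v, fun f => ?_, hchain v, hlast v (hne v)⟩
  rw [← List.mem_toFinset, hmem, Finset.mem_filter]

theorem orientable_faces : Orientable faces := by
  have h : ∀ f ∈ faces, ∀ g ∈ faces, f ≠ g → ∀ u ∈ f ∩ g, succ f u ∈ g →
      succ g (succ f u) = u := by decide +kernel
  refine ⟨succ, by decide +kernel, ?_⟩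
  rintro f hf g hg hfg u _ huf - hug hwg rfl
  exact h f hf g hg hfg u (Finset.mem_inter.mpr ⟨huf, hug⟩) hwg

theorem connected_edges :
    (SimpleGraph.fromEdgeSet (edges : Set (Sym2 (Fin 8)))).Connected := by
  have h : ∀ v : Fin 8, ∃ u,
      (u = 0 ∨ s(0, u) ∈ edges ∧ 0 ≠ u) ∧ (v = u ∨ s(u, v) ∈ edges ∧ u ≠ v) := by
    decide +kernel
  refine SimpleGraph.connected_iff_exists_forall_reachable _ |>.mpr ⟨0, fun v => ?_⟩
  have key : ∀ a b : Fin 8, (b = a ∨ s(a, b) ∈ edges ∧ a ≠ b) →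
      (SimpleGraph.fromEdgeSet (edges : Set (Sym2 (Fin 8)))).Reachable a b := by
    rintro a b (rfl | hab)
    · exact SimpleGraph.Reachable.refl _
    · exact SimpleGraph.Adj.reachable (by simpa using hab)
  obtain ⟨u, h₁, h₂⟩ := h v
  exact (key 0 u h₁).trans (key u v h₂)

theorem isCombTriangulation : IsCombTriangulation edges faces := by
  have hedge : ∀ u v, s(u, v) ∈ edges →
      (faces.filter fun f => u ∈ f ∧ v ∈ f).card = 2 := by decide +kernel
  refine ⟨by decide +kernel, connected_edges, by decide +kernel, ?_, linkIsCycle_faces⟩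
  intro e
  induction e with
  | _ u v =>
    intro h
    rw [← hedge u v h]
    congr 1
    ext f
    simp

theorem nonMono_iff (b : Fin 8 → Bool) :
    (∀ f ∈ faces \ {{1, 3, 7}, {0, 2, 6}}, ¬ ∀ u ∈ f, ∀ v ∈ f, b u = b v) ↔
      b = up ∨ b = fun v => !up v := by
  revert b
  decide +kernel

end SupportingTorus

/-- Supporting triangulations of the torus exist: there is a combinatorial triangulation
`(G, F)` of the torus (orientable, Euler characteristic `0`) and two disjoint faces
`f₁, f₂ ∈ F` such that the spin assignments under which no member of `F \ {f₁, f₂}` is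
monochromatic form exactly one pair `{σ, -σ}`, and moreover neither `f₁` nor `f₂` is
monochromatic under `σ`. -/
theorem supporting_torus_triangulation_exists :
    ∃ (m : ℕ) (E : Finset (Sym2 (Fin m))) (F : Finset (Finset (Fin m))),
      IsCombTriangulation E F ∧
      Orientable F ∧
      (m : ℤ) - (E.card : ℤ) + (F.card : ℤ) = 0 ∧
      ∃ f₁ ∈ F, ∃ f₂ ∈ F, f₁ ∩ f₂ = ∅ ∧
        ∃ σ : Fin m → ℤ, IsSpin σ ∧
          (∀ τ : Fin m → ℤ, IsSpin τ →
            ((∀ f ∈ F \ ({f₁, f₂} : Finset (Finset (Fin m))), ¬ FaceMono τ f)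
              ↔ (τ = σ ∨ τ = -σ))) ∧
          ¬ FaceMono σ f₁ ∧ ¬ FaceMono σ f₂ := by
  refine ⟨8, SupportingTorus.edges, SupportingTorus.faces, SupportingTorus.isCombTriangulation,
    SupportingTorus.orientable_faces, by decide +kernel, {1, 3, 7}, by decide +kernel,
    {0, 2, 6}, by decide +kernel, by decide +kernel, SupportingTorus.spin SupportingTorus.up,
    SupportingTorus.isSpin_spin _, fun τ hτ => ?_, ?_, ?_⟩
  · obtain ⟨b, rfl⟩ := SupportingTorus.exists_eq_spin hτ
    simp only [SupportingTorus.faceMono_spin_iff, SupportingTorus.neg_spin,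
      SupportingTorus.spin_injective.eq_iff]
    exact SupportingTorus.nonMono_iff b
  · rw [SupportingTorus.faceMono_spin_iff]
    decide +kernel
  · rw [SupportingTorus.faceMono_spin_iff]
    decide +kernel
end
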